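/- arXiv:1712.00594 — 2 statements merged into one kernel-verified Lean document; each statement's English description precedes it below -/
import Mathlib

section
/- Let I ⊂ [0,π) be an interval with ℋ¹(I) > 0. There exists a constant c > 0, depending only on ℋ¹(I), such that for every compact set E ⊂ ℂ and every finite Borel measure μ supported on E with 0 < ∫_I ‖P_θμ‖₂² dθ, the analytic capacity of E satisfies γ(E) ≥ c · μ(E)² / ∫_I ‖P_θμ‖₂² dθ. -/
open MeasureTheory Measure Set Filter Metric
open scoped ENNReal Real Topology Classical

/-- Coordinate of the orthogonal projection of `z ∈ ℂ` onto the line `L_θ = {r e^{iθ}}`. -/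
noncomputable def projCoord (θ : ℝ) (z : ℂ) : ℝ :=
  (z * Complex.exp (-(θ : ℂ) * Complex.I)).re

/-- Orthogonal projection of `z ∈ ℂ` onto the line `L_θ`, as a point of `ℂ`. -/
noncomputable def projPt (θ : ℝ) (z : ℂ) : ℂ :=
  (projCoord θ z : ℂ) * Complex.exp ((θ : ℂ) * Complex.I)

/-- `‖P_θ μ‖₂²`: the squared `L²` norm of the density of the projection of `μ` onto `L_θ`
(w.r.t. length), equal to `∞` if the projection is not absolutely continuous with
square-integrable density. -/
noncomputable def projL2sq (θ : ℝ) (μ : Measure ℂ) : ℝ≥0∞ :=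
  if _h : (μ.map (projCoord θ)) ≪ (volume : Measure ℝ) then
    ∫⁻ r, ((μ.map (projCoord θ)).rnDeriv volume r) ^ 2
  else ⊤

/-- Analytic capacity of `E ⊆ ℂ`: `sup |f'(∞)|` over functions `f` holomorphic and bounded
by 1 in modulus on `ℂ \ E`, where `f'(∞) = lim_{z→∞} z(f(z) - f(∞))`. -/
noncomputable def analyticCapacity (E : Set ℂ) : ℝ :=
  sSup {c | ∃ f : ℂ → ℂ, DifferentiableOn ℂ f Eᶜ ∧ (∀ z ∈ Eᶜ, ‖f z‖ ≤ 1) ∧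
    ∃ w d : ℂ, Tendsto f (cocompact ℂ) (𝓝 w) ∧
      Tendsto (fun z => z * (f z - w)) (cocompact ℂ) (𝓝 d) ∧ c = ‖d‖}

/-- The symmetrization of the kernel `1 / z` over a triple; half of the squared Menger curvature. -/
noncomputable def cauchyPerm (a b c : ℂ) : ℝ :=
  ((a - b)⁻¹ * (starRingEnd ℂ) (a - c)⁻¹ + (b - a)⁻¹ * (starRingEnd ℂ) (b - c)⁻¹
    + (c - a)⁻¹ * (starRingEnd ℂ) (c - b)⁻¹).re

/-- The double cone of aperture `κ` around the imaginary axis. -/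
def vertCone (κ : ℝ) : Set ℂ := {v | |v.re| ≤ κ * |v.im|}

/-- Denominator of `coneKer`. -/
noncomputable def coneDenom (κ : ℝ) (v : ℂ) : ℝ :=
  max (v.re ^ 2 - κ ^ 2 / 2 * v.im ^ 2) (κ ^ 2 / 4 * (v.re ^ 2 + v.im ^ 2))

/-- An odd Calderón–Zygmund kernel of homogeneity `-1` equal to `x / (x² - κ² y² / 2)` outside
the vertical cone. -/
noncomputable def coneKer (κ : ℝ) (v : ℂ) : ℝ := v.re / coneDenom κ v

/-- The symmetrization of `coneKer` over a triple. -/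
noncomputable def conePerm (κ : ℝ) (a b c : ℂ) : ℝ :=
  coneKer κ (a - b) * coneKer κ (a - c) + coneKer κ (b - a) * coneKer κ (b - c)
    + coneKer κ (c - a) * coneKer κ (c - b)

lemma sq_norm_eq_re_im (v : ℂ) : ‖v‖ ^ 2 = v.re ^ 2 + v.im ^ 2 := by
  rw [Complex.sq_norm, Complex.normSq_apply]; ring

lemma cauchyPerm_rotate (a b c : ℂ) : cauchyPerm b c a = cauchyPerm a b c := by
  unfold cauchyPerm
  simp only [Complex.add_re, Complex.mul_re, Complex.conj_re, Complex.conj_im]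
  ring

lemma cauchyPerm_mul {e : ℂ} (he : ‖e‖ = 1) (a b c : ℂ) :
    cauchyPerm (a * e) (b * e) (c * e) = cauchyPerm a b c := by
  have h : e⁻¹ * (starRingEnd ℂ) e⁻¹ = 1 := by
    rw [Complex.mul_conj, Complex.normSq_eq_norm_sq, norm_inv, he]; simp
  have key : ∀ u v : ℂ, (u * e)⁻¹ * (starRingEnd ℂ) (v * e)⁻¹ = u⁻¹ * (starRingEnd ℂ) v⁻¹ := by
    intro u v
    rw [mul_inv, mul_inv, map_mul]
    linear_combination (u⁻¹ * (starRingEnd ℂ) v⁻¹) * h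
  unfold cauchyPerm
  simp only [← sub_mul, key]

lemma cauchyPerm_eq {a b c : ℂ} (hab : a ≠ b) (hbc : b ≠ c) (hca : c ≠ a) :
    cauchyPerm a b c = 2 * ((a - b).re * (b - c).im - (a - b).im * (b - c).re) ^ 2 /
      (‖a - b‖ ^ 2 * ‖b - c‖ ^ 2 * ‖a - c‖ ^ 2) := by
  have h1 : ‖a - b‖ ^ 2 ≠ 0 := by simpa [sub_eq_zero] using hab
  have h2 : ‖b - c‖ ^ 2 ≠ 0 := by simpa [sub_eq_zero] using hbc
  have h3 : ‖a - c‖ ^ 2 ≠ 0 := by simpa [sub_eq_zero] using hca.symm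
  have e1 : (b - a)⁻¹ = -(a - b)⁻¹ := by rw [← neg_sub a b, inv_neg]
  have e2 : (c - a)⁻¹ = -(a - c)⁻¹ := by rw [← neg_sub a c, inv_neg]
  have e3 : (c - b)⁻¹ = -(b - c)⁻¹ := by rw [← neg_sub b c, inv_neg]
  unfold cauchyPerm
  rw [e1, e2, e3]
  simp only [Complex.add_re, Complex.mul_re, Complex.conj_re, Complex.conj_im, Complex.neg_re,
    Complex.neg_im, Complex.inv_re, Complex.inv_im, Complex.normSq_eq_norm_sq, map_neg]
  rw [eq_div_iff (by positivity)]
  have k1 := sq_norm_eq_re_im (a - b)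
  have k2 := sq_norm_eq_re_im (b - c)
  have k3 := sq_norm_eq_re_im (a - c)
  generalize ‖a - b‖ ^ 2 = U at *
  generalize ‖b - c‖ ^ 2 = V at *
  generalize ‖a - c‖ ^ 2 = W at *
  field_simp
  simp only [Complex.sub_re, Complex.sub_im] at *
  subst k1 k2 k3
  ring

lemma cauchyPerm_self_left (a c : ℂ) : cauchyPerm a a c = 1 / ‖a - c‖ ^ 2 := by
  unfold cauchyPerm
  rw [Complex.mul_conj]
  simp [Complex.normSq_eq_norm_sq, norm_sub_rev]
  rw [← Complex.ofReal_pow, Complex.ofReal_re]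
  by_cases h : ‖a - c‖ = 0
  · simp [h]
  field_simp

lemma cauchyPerm_nonneg (a b c : ℂ) : 0 ≤ cauchyPerm a b c := by
  by_cases hab : a = b
  · subst hab; rw [cauchyPerm_self_left]; positivity
  by_cases hbc : b = c
  · subst hbc; rw [← cauchyPerm_rotate, cauchyPerm_self_left]; positivity
  by_cases hca : c = a
  · subst hca; rw [← cauchyPerm_rotate, ← cauchyPerm_rotate, cauchyPerm_self_left]; positivity
  rw [cauchyPerm_eq hab hbc hca]; positivity

lemma cauchyPerm_le_of_ne {a b c : ℂ} (hab : a ≠ b) (hbc : b ≠ c) (hca : c ≠ a) :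
    cauchyPerm a b c ≤ 2 / ‖a - c‖ ^ 2 := by
  have h1 : 0 < ‖a - b‖ ^ 2 := by have := norm_pos_iff.2 (sub_ne_zero.2 hab); positivity
  have h2 : 0 < ‖b - c‖ ^ 2 := by have := norm_pos_iff.2 (sub_ne_zero.2 hbc); positivity
  have h3 : 0 < ‖a - c‖ ^ 2 := by have := norm_pos_iff.2 (sub_ne_zero.2 hca.symm); positivity
  rw [cauchyPerm_eq hab hbc hca, div_le_div_iff₀ (by positivity) h3]
  have : ((a - b).re * (b - c).im - (a - b).im * (b - c).re) ^ 2 ≤ ‖a - b‖ ^ 2 * ‖b - c‖ ^ 2 := by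
    rw [sq_norm_eq_re_im, sq_norm_eq_re_im]
    nlinarith [sq_nonneg ((a - b).re * (b - c).re + (a - b).im * (b - c).im)]
  nlinarith

lemma cauchyPerm_le (a b c : ℂ) : cauchyPerm a b c ≤ 2 / (max ‖a - b‖ ‖a - c‖) ^ 2 := by
  have hpos : ∀ x : ℝ, 1 / x ^ 2 ≤ 2 / x ^ 2 := fun x => by gcongr; norm_num
  by_cases hab : a = b
  · subst hab; rw [cauchyPerm_self_left]; simpa using hpos _
  by_cases hbc : b = c
  · subst hbc; rw [← cauchyPerm_rotate, cauchyPerm_self_left, norm_sub_rev]; simpa using hpos _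
  by_cases hca : c = a
  · subst hca; rw [← cauchyPerm_rotate, ← cauchyPerm_rotate, cauchyPerm_self_left]
    simpa using hpos _
  rcases max_choice ‖a - b‖ ‖a - c‖ with h | h <;> rw [h]
  · rw [← cauchyPerm_rotate, norm_sub_rev]
    exact cauchyPerm_le_of_ne hbc hca hab
  · exact cauchyPerm_le_of_ne hab hbc hca

lemma coneKer_neg (κ : ℝ) (v : ℂ) : coneKer κ (-v) = -coneKer κ v := by
  simp [coneKer, coneDenom, neg_div]

lemma coneKer_zero (κ : ℝ) : coneKer κ 0 = 0 := by simp [coneKer]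

lemma coneKer_sub_comm (κ : ℝ) (a b : ℂ) : coneKer κ (a - b) = -coneKer κ (b - a) := by
  rw [← coneKer_neg, neg_sub]

lemma le_coneDenom (κ : ℝ) (v : ℂ) : κ ^ 2 / 4 * ‖v‖ ^ 2 ≤ coneDenom κ v := by
  rw [sq_norm_eq_re_im]; exact le_max_right _ _

lemma coneDenom_le {κ : ℝ} (h0 : 0 < κ) (h1 : κ ≤ 1) (v : ℂ) : coneDenom κ v ≤ ‖v‖ ^ 2 := by
  rw [sq_norm_eq_re_im]
  have : κ ^ 2 ≤ 1 := by nlinarith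
  refine max_le ?_ ?_ <;> nlinarith [sq_nonneg v.re, sq_nonneg v.im, sq_nonneg κ,
    mul_nonneg (sq_nonneg κ) (sq_nonneg v.im)]

lemma coneDenom_pos {κ : ℝ} (h0 : 0 < κ) {v : ℂ} (hv : v ≠ 0) : 0 < coneDenom κ v := by
  have := norm_pos_iff.2 hv
  exact lt_of_lt_of_le (by positivity) (le_coneDenom κ v)

lemma abs_sq_sub_sq_le (a b : ℝ) {s t : ℝ} (h1 : |a - b| ≤ s) (h2 : |a| + |b| ≤ t) :
    |a ^ 2 - b ^ 2| ≤ s * t := by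
  have : a ^ 2 - b ^ 2 = (a - b) * (a + b) := by ring
  rw [this, abs_mul]
  exact mul_le_mul h1 ((abs_add_le a b).trans h2) (abs_nonneg _) ((abs_nonneg _).trans h1)

lemma abs_coneDenom_sub_le {κ : ℝ} (h0 : 0 < κ) (h1 : κ ≤ 1) (v w : ℂ) :
    |coneDenom κ v - coneDenom κ w| ≤ 2 * ‖v - w‖ * (‖v‖ + ‖w‖) := by
  have hκ : κ ^ 2 ≤ 1 := by nlinarith
  have hr : |v.re ^ 2 - w.re ^ 2| ≤ ‖v - w‖ * (‖v‖ + ‖w‖) :=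
    abs_sq_sub_sq_le _ _ (by simpa using Complex.abs_re_le_norm (v - w))
      (add_le_add (Complex.abs_re_le_norm v) (Complex.abs_re_le_norm w))
  have hi : |v.im ^ 2 - w.im ^ 2| ≤ ‖v - w‖ * (‖v‖ + ‖w‖) :=
    abs_sq_sub_sq_le _ _ (by simpa using Complex.abs_im_le_norm (v - w))
      (add_le_add (Complex.abs_im_le_norm v) (Complex.abs_im_le_norm w))
  refine (abs_max_sub_max_le_max _ _ _ _).trans ?_
  set N := ‖v - w‖ * (‖v‖ + ‖w‖) with hN
  have hN0 : 0 ≤ N := by positivity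
  rw [mul_assoc, ← hN]
  rw [abs_le] at hr hi
  refine max_le (abs_le.2 ⟨?_, ?_⟩) (abs_le.2 ⟨?_, ?_⟩) <;>
  nlinarith [mul_nonneg (sq_nonneg κ) (sub_nonneg.2 hr.1), mul_nonneg (sq_nonneg κ) (sub_nonneg.2 hr.2),
    mul_nonneg (sq_nonneg κ) (sub_nonneg.2 hi.1), mul_nonneg (sq_nonneg κ) (sub_nonneg.2 hi.2),
    mul_nonneg hN0 (sub_nonneg.2 hκ)]

lemma abs_coneKer_le {κ : ℝ} (h0 : 0 < κ) (v : ℂ) : |coneKer κ v| ≤ 4 / κ ^ 2 / ‖v‖ := by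
  by_cases hv : v = 0
  · simp [hv, coneKer_zero]
  have hn := norm_pos_iff.2 hv
  rw [coneKer, abs_div, abs_of_pos (coneDenom_pos h0 hv), div_div,
    div_le_div_iff₀ (coneDenom_pos h0 hv) (by positivity)]
  have h2 := le_coneDenom κ v
  have h3 := Complex.abs_re_le_norm v
  calc |v.re| * (κ ^ 2 * ‖v‖) ≤ ‖v‖ * (κ ^ 2 * ‖v‖) := by gcongr
    _ ≤ 4 * coneDenom κ v := by nlinarith

lemma abs_coneKer_sub_le {κ : ℝ} (h0 : 0 < κ) (h1 : κ ≤ 1) {v w : ℂ} (hv : v ≠ 0) (hw : w ≠ 0)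
    (hvw : ‖v‖ ≤ 2 * ‖w‖) : |coneKer κ v - coneKer κ w| ≤ 100 / κ ^ 4 * ‖v - w‖ / ‖v‖ ^ 2 := by
  have hv0 := norm_pos_iff.2 hv
  have hw0 := norm_pos_iff.2 hw
  have hDv := coneDenom_pos h0 hv
  have hDw := coneDenom_pos h0 hw
  have e : coneKer κ v - coneKer κ w = (v.re - w.re) / coneDenom κ v
      + w.re * (coneDenom κ w - coneDenom κ v) / (coneDenom κ v * coneDenom κ w) := by
    unfold coneKer; field_simp; ring
  have b1 : |(v.re - w.re) / coneDenom κ v| ≤ ‖v - w‖ / (κ ^ 2 / 4 * ‖v‖ ^ 2) := by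
    rw [abs_div, abs_of_pos hDv]
    have := Complex.abs_re_le_norm (v - w)
    exact div_le_div₀ (norm_nonneg _) (by simpa using this) (by positivity) (le_coneDenom κ v)
  have b2 : |w.re * (coneDenom κ w - coneDenom κ v) / (coneDenom κ v * coneDenom κ w)| ≤
      (‖w‖ * (2 * ‖v - w‖ * (3 * ‖w‖))) / ((κ ^ 2 / 4 * ‖v‖ ^ 2) * (κ ^ 2 / 4 * ‖w‖ ^ 2)) := by
    rw [abs_div, abs_of_pos (mul_pos hDv hDw), abs_mul]
    have h3 : |coneDenom κ w - coneDenom κ v| ≤ 2 * ‖v - w‖ * (3 * ‖w‖) := by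
      rw [abs_sub_comm]
      refine (abs_coneDenom_sub_le h0 h1 v w).trans ?_
      gcongr
      linarith
    have h4 := le_coneDenom κ v
    have h5 := le_coneDenom κ w
    have h6 := Complex.abs_re_le_norm w
    gcongr
  rw [e]
  refine (abs_add_le _ _).trans ((add_le_add b1 b2).trans ?_)
  have e2 : ‖v - w‖ / (κ ^ 2 / 4 * ‖v‖ ^ 2) + (‖w‖ * (2 * ‖v - w‖ * (3 * ‖w‖))) /
      ((κ ^ 2 / 4 * ‖v‖ ^ 2) * (κ ^ 2 / 4 * ‖w‖ ^ 2)) =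
      (4 * κ ^ 2 + 96) / κ ^ 4 * ‖v - w‖ / ‖v‖ ^ 2 := by
    field_simp; ring
  rw [e2]
  have : κ ^ 2 ≤ 1 := by nlinarith
  gcongr
  linarith

lemma conePerm_rotate (κ : ℝ) (a b c : ℂ) : conePerm κ b c a = conePerm κ a b c := by
  unfold conePerm; ring

lemma conePerm_swap (κ : ℝ) (a b c : ℂ) : conePerm κ b a c = conePerm κ a b c := by
  unfold conePerm; ring

lemma abs_conePerm_le_of_le {κ : ℝ} (h0 : 0 < κ) (h1 : κ ≤ 1) {a b c : ℂ}
    (hab : ‖a - b‖ ≤ ‖a - c‖) (hbc : ‖a - b‖ ≤ ‖b - c‖) :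
    |conePerm κ a b c| ≤ 432 / κ ^ 6 / ‖a - c‖ ^ 2 := by
  have e : conePerm κ a b c = coneKer κ (a - b) * (coneKer κ (a - c) - coneKer κ (b - c))
      + coneKer κ (a - c) * coneKer κ (b - c) := by
    unfold conePerm
    rw [coneKer_sub_comm κ b a, coneKer_sub_comm κ c a, coneKer_sub_comm κ c b]; ring
  have htri : ‖a - c‖ ≤ 2 * ‖b - c‖ := by
    have := norm_add_le (a - b) (b - c)
    rw [sub_add_sub_cancel] at this
    linarith
  by_cases hac : a - c = 0
  · rw [hac, norm_zero] at hab
    have hab' : a - b = 0 := norm_le_zero_iff.1 hab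
    rw [e, hac, hab', coneKer_zero]; simp
  have hac0 := norm_pos_iff.2 hac
  have hbc0 : 0 < ‖b - c‖ := by linarith
  have hκ : κ ^ 2 ≤ 1 := by nlinarith
  have t1 : |coneKer κ (a - b) * (coneKer κ (a - c) - coneKer κ (b - c))| ≤
      400 / κ ^ 6 / ‖a - c‖ ^ 2 := by
    by_cases hab' : a - b = 0
    · rw [hab', coneKer_zero, zero_mul, abs_zero]; positivity
    have hab0 := norm_pos_iff.2 hab'
    have hd := abs_coneKer_sub_le h0 h1 hac (norm_pos_iff.1 hbc0) htri
    rw [sub_sub_sub_cancel_right] at hd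
    rw [abs_mul]
    calc _ ≤ (4 / κ ^ 2 / ‖a - b‖) * (100 / κ ^ 4 * ‖a - b‖ / ‖a - c‖ ^ 2) :=
          mul_le_mul (abs_coneKer_le h0 _) hd (abs_nonneg _) (by positivity)
      _ = _ := by field_simp; norm_num
  have t2 : |coneKer κ (a - c) * coneKer κ (b - c)| ≤ 32 / κ ^ 6 / ‖a - c‖ ^ 2 := by
    rw [abs_mul]
    calc _ ≤ (4 / κ ^ 2 / ‖a - c‖) * (4 / κ ^ 2 / ‖b - c‖) :=
          mul_le_mul (abs_coneKer_le h0 _) (abs_coneKer_le h0 _) (abs_nonneg _) (by positivity)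
      _ ≤ (4 / κ ^ 2 / ‖a - c‖) * (4 / κ ^ 2 / (‖a - c‖ / 2)) := by
          gcongr; linarith
      _ = κ ^ 2 * 32 / κ ^ 6 / ‖a - c‖ ^ 2 := by field_simp; norm_num
      _ ≤ 1 * 32 / κ ^ 6 / ‖a - c‖ ^ 2 := by gcongr
      _ = _ := by ring
  rw [e]
  calc _ ≤ _ := (abs_add_le _ _).trans (add_le_add t1 t2)
    _ = _ := by ring

lemma abs_conePerm_le {κ : ℝ} (h0 : 0 < κ) (h1 : κ ≤ 1) (a b c : ℂ) :
    |conePerm κ a b c| ≤ 432 / κ ^ 6 / (max ‖a - b‖ ‖a - c‖) ^ 2 := by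
  have r1 := norm_sub_rev a b
  have r2 := norm_sub_rev a c
  have r3 := norm_sub_rev b c
  rcases le_total ‖a - b‖ ‖a - c‖ with h | h
  · rw [max_eq_right h]
    rcases le_total ‖a - b‖ ‖b - c‖ with h' | h'
    · exact abs_conePerm_le_of_le h0 h1 h h'
    · rw [← conePerm_rotate, ← conePerm_swap, r2]
      exact abs_conePerm_le_of_le h0 h1 (by linarith) (by linarith)
  · rw [max_eq_left h]
    rcases le_total ‖a - c‖ ‖b - c‖ with h' | h'
    · rw [← conePerm_rotate, ← conePerm_rotate, ← conePerm_swap]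
      exact abs_conePerm_le_of_le h0 h1 (by linarith) (by linarith)
    · rw [← conePerm_rotate, r1]
      exact abs_conePerm_le_of_le h0 h1 (by linarith) (by linarith)

lemma coneDenom_eq_of_notMem {κ : ℝ} (h0 : 0 < κ) (h1 : κ ≤ 1) {v : ℂ} (hv : v ∉ vertCone κ) :
    coneDenom κ v = v.re ^ 2 - κ ^ 2 / 2 * v.im ^ 2 := by
  have h : κ * |v.im| < |v.re| := not_le.1 hv
  have h2 : κ ^ 2 * v.im ^ 2 ≤ v.re ^ 2 := by
    rw [← sq_abs v.im, ← sq_abs v.re, ← mul_pow]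
    gcongr
  have hκ : κ ^ 2 ≤ 1 := by nlinarith
  refine max_eq_left ?_
  nlinarith [mul_nonneg (sq_nonneg v.re) (sub_nonneg.2 hκ)]

lemma cauchyPerm_le_neg_conePerm {κ : ℝ} (h0 : 0 < κ) (h1 : κ ≤ 1) {a b c : ℂ}
    (hab : a - b ∉ vertCone κ) (hbc : b - c ∉ vertCone κ) (hac : a - c ∉ vertCone κ) :
    cauchyPerm a b c ≤ 4 / κ ^ 2 * -conePerm κ a b c := by
  have z0 : (0 : ℂ) ∈ vertCone κ := by simp [vertCone]
  have nab : a - b ≠ 0 := fun h => hab (h ▸ z0)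
  have nbc : b - c ≠ 0 := fun h => hbc (h ▸ z0)
  have nac : a - c ≠ 0 := fun h => hac (h ▸ z0)
  have e : conePerm κ a b c = - (κ ^ 2 / 2 *
      ((a - b).re * (b - c).im - (a - b).im * (b - c).re) ^ 2) /
      (coneDenom κ (a - b) * coneDenom κ (b - c) * coneDenom κ (a - c)) := by
    have d1 := coneDenom_pos h0 nab
    have d2 := coneDenom_pos h0 nbc
    have d3 := coneDenom_pos h0 nac
    unfold conePerm
    rw [coneKer_sub_comm κ b a, coneKer_sub_comm κ c a, coneKer_sub_comm κ c b]
    unfold coneKer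
    have k1 := coneDenom_eq_of_notMem h0 h1 hab
    have k2 := coneDenom_eq_of_notMem h0 h1 hbc
    have k3 := coneDenom_eq_of_notMem h0 h1 hac
    generalize coneDenom κ (a - b) = U at *
    generalize coneDenom κ (b - c) = V at *
    generalize coneDenom κ (a - c) = W at *
    field_simp
    simp only [Complex.sub_re, Complex.sub_im] at *
    subst k1 k2 k3
    ring
  rw [e, cauchyPerm_eq (sub_ne_zero.1 nab) (sub_ne_zero.1 nbc) (sub_ne_zero.1 nac).symm]
  have d1 := coneDenom_pos h0 nab
  have d2 := coneDenom_pos h0 nbc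
  have d3 := coneDenom_pos h0 nac
  have l1 := coneDenom_le h0 h1 (a - b)
  have l2 := coneDenom_le h0 h1 (b - c)
  have l3 := coneDenom_le h0 h1 (a - c)
  set S := ((a - b).re * (b - c).im - (a - b).im * (b - c).re) ^ 2
  have hS : 0 ≤ S := sq_nonneg _
  calc 2 * S / (‖a - b‖ ^ 2 * ‖b - c‖ ^ 2 * ‖a - c‖ ^ 2) ≤
      2 * S / (coneDenom κ (a - b) * coneDenom κ (b - c) * coneDenom κ (a - c)) := by gcongr
    _ = _ := by field_simp; ring

/-- Pointwise comparison of the two symmetrizations, up to triples containing a pair in the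
vertical cone. -/
lemma cauchyPerm_le_conePerm_add {κ : ℝ} (h0 : 0 < κ) (h1 : κ ≤ 1) (a b c : ℂ) :
    cauchyPerm a b c ≤ 4 / κ ^ 2 * -conePerm κ a b c + 1730 / κ ^ 8 *
      ((if a - b ∈ vertCone κ then 1 / (max ‖a - b‖ ‖a - c‖) ^ 2 else 0) +
       (if b - c ∈ vertCone κ then 1 / (max ‖b - c‖ ‖b - a‖) ^ 2 else 0) +
       (if c - a ∈ vertCone κ then 1 / (max ‖c - a‖ ‖c - b‖) ^ 2 else 0)) := by
  have key : ∀ a b c : ℂ, cauchyPerm a b c ≤ 4 / κ ^ 2 * -conePerm κ a b c + 1730 / κ ^ 8 *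
      (1 / (max ‖a - b‖ ‖a - c‖) ^ 2) := by
    intro a b c
    have hq := cauchyPerm_le a b c
    have hp := neg_le_of_abs_le (abs_conePerm_le h0 h1 a b c)
    have hp' := le_of_abs_le (abs_conePerm_le h0 h1 a b c)
    set M := 1 / (max ‖a - b‖ ‖a - c‖) ^ 2 with hM
    have hM0 : 0 ≤ M := by positivity
    have hκ8 : κ ^ 8 ≤ 1 := pow_le_one₀ h0.le h1
    have e1 : (2 : ℝ) / (max ‖a - b‖ ‖a - c‖) ^ 2 = 2 * M := by rw [hM]; ring
    have e2 : 432 / κ ^ 6 / (max ‖a - b‖ ‖a - c‖) ^ 2 = 432 / κ ^ 6 * M := by rw [hM]; ring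
    rw [e1] at hq
    rw [e2] at hp'
    have h3 : 4 / κ ^ 2 * conePerm κ a b c ≤ 4 / κ ^ 2 * (432 / κ ^ 6 * M) := by gcongr
    have h4 : 4 / κ ^ 2 * (432 / κ ^ 6 * M) = 1728 / κ ^ 8 * M := by
      field_simp; ring
    have h5 : 2 * M ≤ 2 / κ ^ 8 * M := by
      gcongr
      rw [le_div_iff₀ (by positivity)]; linarith
    have h6 : 1730 / κ ^ 8 * M = 1728 / κ ^ 8 * M + 2 / κ ^ 8 * M := by ring
    linarith
  have nn : ∀ (p : Prop) [Decidable p] (x y : ℝ), 0 ≤ (if p then 1 / (max x y) ^ 2 else 0) := by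
    intro p _ x y; split_ifs <;> positivity
  have hC : 0 ≤ 1730 / κ ^ 8 := by positivity
  by_cases hab : a - b ∈ vertCone κ
  · refine (key a b c).trans ?_
    rw [if_pos hab]
    gcongr
    linarith [nn (b - c ∈ vertCone κ) ‖b - c‖ ‖b - a‖, nn (c - a ∈ vertCone κ) ‖c - a‖ ‖c - b‖]
  by_cases hbc : b - c ∈ vertCone κ
  · have := key b c a
    rw [cauchyPerm_rotate, conePerm_rotate] at this
    refine this.trans ?_
    rw [if_pos hbc]
    gcongr
    linarith [nn (a - b ∈ vertCone κ) ‖a - b‖ ‖a - c‖, nn (c - a ∈ vertCone κ) ‖c - a‖ ‖c - b‖]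
  by_cases hca : c - a ∈ vertCone κ
  · have := key c a b
    rw [← cauchyPerm_rotate c a b, ← conePerm_rotate κ c a b] at this
    refine this.trans ?_
    rw [if_pos hca]
    gcongr
    linarith [nn (a - b ∈ vertCone κ) ‖a - b‖ ‖a - c‖, nn (b - c ∈ vertCone κ) ‖b - c‖ ‖b - a‖]
  have hac : a - c ∉ vertCone κ := by
    intro h; apply hca
    simp only [vertCone, mem_ofPred_eq, Complex.sub_re, Complex.sub_im] at h ⊢
    rwa [abs_sub_comm, abs_sub_comm c.im]
  rw [if_neg hab, if_neg hbc, if_neg hca]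
  simpa using cauchyPerm_le_neg_conePerm h0 h1 hab hbc hac

/-- Dyadic estimate for tails of a weighted family with linear growth above scale `ε`. -/
lemma sum_div_mul_sqrt_le {ι : Type*} (s : Finset ι) (m d : ι → ℝ) (hm : ∀ i, 0 ≤ m i) {ε : ℝ}
    (hε : 0 < ε) (hG : ∀ r, ε ≤ r → ∑ i ∈ s with d i ≤ r, m i ≤ r) {r : ℝ} (hr : ε ≤ r) :
    ∑ i ∈ s with r ≤ d i, m i / (d i * √(d i)) ≤ 7 / √r := by
  have shell : ∀ t, ε ≤ t → ∑ i ∈ s with t ≤ d i ∧ d i ≤ 2 * t, m i / (d i * √(d i)) ≤ 2 / √t := by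
    intro t ht
    have ht0 : 0 < t := hε.trans_le ht
    calc ∑ i ∈ s with t ≤ d i ∧ d i ≤ 2 * t, m i / (d i * √(d i))
        ≤ ∑ i ∈ s with t ≤ d i ∧ d i ≤ 2 * t, m i / (t * √t) := by
          refine Finset.sum_le_sum fun i hi => ?_
          have hi' := (Finset.mem_filter.1 hi).2.1
          have h1 := hm i
          have h2 : 0 ≤ d i := ht0.le.trans hi'
          gcongr
      _ ≤ ∑ i ∈ s with d i ≤ 2 * t, m i / (t * √t) := by
          refine Finset.sum_le_sum_of_subset_of_nonneg ?_ ?_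
          · intro i hi
            simp only [Finset.mem_filter] at hi ⊢
            exact ⟨hi.1, hi.2.2⟩
          · intro i _ _
            have := hm i
            positivity
      _ = (∑ i ∈ s with d i ≤ 2 * t, m i) / (t * √t) := by rw [Finset.sum_div]
      _ ≤ 2 * t / (t * √t) := by
          gcongr
          exact hG _ (by linarith)
      _ = 2 / √t := by field_simp
  have main : ∀ n : ℕ, ∀ t, ε ≤ t → (∀ i ∈ s, d i ≤ 2 ^ n * t) →
      ∑ i ∈ s with t ≤ d i, m i / (d i * √(d i)) ≤ 7 / √t := by
    intro n
    induction n with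
    | zero =>
      intro t ht hd
      have ht0 : 0 < t := hε.trans_le ht
      refine le_trans (Finset.sum_le_sum_of_subset_of_nonneg ?_ ?_) ((shell t ht).trans ?_)
      · intro i hi
        simp only [Finset.mem_filter] at hi ⊢
        have := hd i hi.1
        exact ⟨hi.1, hi.2, by linarith⟩
      · intro i hi _
        have := hm i
        have h2 := (Finset.mem_filter.1 hi).2.1
        have : 0 ≤ d i := by linarith
        positivity
      · gcongr; norm_num
    | succ n ih =>
      intro t ht hd
      have ht0 : 0 < t := hε.trans_le ht
      have h1 := ih (2 * t) (by linarith) (fun i hi => (hd i hi).trans (by rw [pow_succ]; linarith))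
      have h2 := shell t ht
      have hsq : 7 / √(2 * t) ≤ 5 / √t := by
        rw [Real.sqrt_mul (by norm_num), ← div_div]
        gcongr
        rw [div_le_iff₀ (by positivity)]
        have : (1.4 : ℝ) ≤ √2 := Real.le_sqrt_of_sq_le (by norm_num)
        linarith
      have hsub : ∑ i ∈ s with t ≤ d i, m i / (d i * √(d i)) ≤
          ∑ i ∈ s with t ≤ d i ∧ d i ≤ 2 * t, m i / (d i * √(d i)) +
          ∑ i ∈ s with 2 * t ≤ d i, m i / (d i * √(d i)) := by
        simp only [Finset.sum_filter, ← Finset.sum_add_distrib]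
        refine Finset.sum_le_sum fun i _ => ?_
        by_cases h : t ≤ d i
        · have : 0 ≤ m i / (d i * √(d i)) := by
            have := hm i
            have : 0 ≤ d i := by linarith
            positivity
          rcases le_total (d i) (2 * t) with h' | h'
          · rw [if_pos h, if_pos ⟨h, h'⟩]; split_ifs <;> linarith
          · rw [if_pos h, if_pos h']; split_ifs <;> linarith
        · rw [if_neg h, if_neg (fun h' => h h'.1), if_neg (by linarith)]; simp
      have e : 7 / √t = 2 / √t + 5 / √t := by ring
      linarith
  obtain ⟨D, hD⟩ : ∃ D, ∀ i ∈ s, d i ≤ D := by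
    simpa using (s.image d).exists_le
  have hr0 : 0 < r := hε.trans_le hr
  obtain ⟨n, hn⟩ := pow_unbounded_of_one_lt (D / r) (one_lt_two)
  refine main n r hr fun i hi => (hD i hi).trans ?_
  rw [div_lt_iff₀ hr0] at hn
  exact hn.le

lemma sum_div_sq_le {ι : Type*} (s : Finset ι) (m d : ι → ℝ) (hm : ∀ i, 0 ≤ m i) {ε : ℝ}
    (hε : 0 < ε) (hG : ∀ r, ε ≤ r → ∑ i ∈ s with d i ≤ r, m i ≤ r) {r : ℝ} (hr : ε ≤ r) :
    ∑ i ∈ s with r ≤ d i, m i / d i ^ 2 ≤ 7 / r := by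
  have hr0 : 0 < r := hε.trans_le hr
  have h := sum_div_mul_sqrt_le s m d hm hε hG hr
  calc ∑ i ∈ s with r ≤ d i, m i / d i ^ 2
      ≤ ∑ i ∈ s with r ≤ d i, m i / (d i * √(d i)) * (1 / √r) := by
        refine Finset.sum_le_sum fun i hi => ?_
        have hi' := (Finset.mem_filter.1 hi).2
        have hd : 0 < d i := by linarith
        have := hm i
        calc m i / d i ^ 2 = m i / (d i * √(d i)) * (1 / √(d i)) := by
              rw [div_mul_div_comm, mul_one, mul_assoc, Real.mul_self_sqrt hd.le, sq]
          _ ≤ _ := by gcongr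
    _ = (∑ i ∈ s with r ≤ d i, m i / (d i * √(d i))) * (1 / √r) := by rw [Finset.sum_mul]
    _ ≤ 7 / √r * (1 / √r) := by gcongr
    _ = 7 / r := by rw [div_mul_div_comm, mul_one, Real.mul_self_sqrt hr0.le]

lemma sum_div_max_sq_le {s : Finset ℂ} {m : ℂ → ℝ} (hm : ∀ i, 0 ≤ m i) {ε : ℝ} (hε : 0 < ε)
    {a b : ℂ} (hG : ∀ r, ε ≤ r → ∑ c ∈ s with ‖a - c‖ ≤ r, m c ≤ r) (hab : ε ≤ ‖a - b‖) :
    ∑ c ∈ s, m c * (1 / (max ‖a - b‖ ‖a - c‖) ^ 2) ≤ 8 / ‖a - b‖ := by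
  set d := ‖a - b‖
  have hd : 0 < d := hε.trans_le hab
  have h1 : (∑ c ∈ s with ‖a - c‖ ≤ d, m c) * (1 / d ^ 2) ≤ d * (1 / d ^ 2) := by
    gcongr
    exact hG d hab
  have h2 := sum_div_sq_le s m (fun c => ‖a - c‖) hm hε hG hab
  have h3 : ∑ c ∈ s, m c * (1 / (max d ‖a - c‖) ^ 2) ≤
      (∑ c ∈ s with ‖a - c‖ ≤ d, m c) * (1 / d ^ 2) +
        ∑ c ∈ s with d ≤ ‖a - c‖, m c / ‖a - c‖ ^ 2 := by
    rw [Finset.sum_mul]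
    simp only [Finset.sum_filter, ← Finset.sum_add_distrib]
    refine Finset.sum_le_sum fun c _ => ?_
    have := hm c
    have p1 : 0 ≤ m c * (1 / d ^ 2) := by positivity
    have p2 : 0 ≤ m c / ‖a - c‖ ^ 2 := by positivity
    rcases le_total ‖a - c‖ d with h | h
    · rw [max_eq_left h, if_pos h]
      split_ifs <;> linarith
    · rw [max_eq_right h, if_pos h, mul_one_div]
      split_ifs <;> linarith
  have e : d * (1 / d ^ 2) + 7 / d = 8 / d := by field_simp; norm_num
  linarith

lemma sum_div_norm_sq_le {s : Finset ℂ} {m : ℂ → ℝ} (hm : ∀ i, 0 ≤ m i) {ε : ℝ} (hε : 0 < ε)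
    {a : ℂ} (hG : ∀ r, ε ≤ r → ∑ c ∈ s with ‖a - c‖ ≤ r, m c ≤ r)
    (hS : ∀ c ∈ s, a ≠ c → ε ≤ ‖a - c‖) :
    ∑ c ∈ s, m c / ‖a - c‖ ^ 2 ≤ 7 / ε := by
  refine le_trans (le_of_eq ?_) (sum_div_sq_le s m (fun c => ‖a - c‖) hm hε hG le_rfl)
  symm
  refine Finset.sum_subset (Finset.filter_subset _ _) fun c hc hc' => ?_
  by_cases h : a = c
  · simp [h]
  · exact absurd (Finset.mem_filter.2 ⟨hc, hS c hc h⟩) hc'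

lemma sum_rotate {ι : Type*} (s : Finset ι) (f : ι → ι → ι → ℝ) :
    ∑ a ∈ s, ∑ b ∈ s, ∑ c ∈ s, f b c a = ∑ a ∈ s, ∑ b ∈ s, ∑ c ∈ s, f a b c := by
  rw [Finset.sum_comm]
  exact Finset.sum_congr rfl fun b _ => Finset.sum_comm

lemma sum_conePerm_nonneg (s : Finset ℂ) (m : ℂ → ℝ) (hm : ∀ i, 0 ≤ m i) (κ : ℝ) (e : ℂ) :
    0 ≤ ∑ a ∈ s, ∑ b ∈ s, ∑ c ∈ s, m a * m b * m c * conePerm κ (a * e) (b * e) (c * e) := by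
  set g : ℂ → ℂ → ℂ → ℝ := fun a b c => m a * m b * m c *
    (coneKer κ (a * e - b * e) * coneKer κ (a * e - c * e)) with hg
  have h1 : 0 ≤ ∑ a ∈ s, ∑ b ∈ s, ∑ c ∈ s, g a b c := by
    refine Finset.sum_nonneg fun a _ => ?_
    have : ∑ b ∈ s, ∑ c ∈ s, g a b c = m a * ((∑ b ∈ s, m b * coneKer κ (a * e - b * e)) *
        ∑ c ∈ s, m c * coneKer κ (a * e - c * e)) := by
      rw [Finset.sum_mul_sum, Finset.mul_sum]
      refine Finset.sum_congr rfl fun b _ => ?_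
      rw [Finset.mul_sum]
      refine Finset.sum_congr rfl fun c _ => ?_
      rw [hg]; ring
    rw [this]
    exact mul_nonneg (hm a) (mul_self_nonneg _)
  have h2 := sum_rotate s g
  have h3 := sum_rotate s (fun a b c => g b c a)
  have h4 : ∑ a ∈ s, ∑ b ∈ s, ∑ c ∈ s, m a * m b * m c * conePerm κ (a * e) (b * e) (c * e) =
      ∑ a ∈ s, ∑ b ∈ s, ∑ c ∈ s, g a b c + ∑ a ∈ s, ∑ b ∈ s, ∑ c ∈ s, g b c a +
        ∑ a ∈ s, ∑ b ∈ s, ∑ c ∈ s, g c a b := by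
    simp only [← Finset.sum_add_distrib]
    refine Finset.sum_congr rfl fun a _ => Finset.sum_congr rfl fun b _ =>
      Finset.sum_congr rfl fun c _ => ?_
    rw [hg, conePerm]; ring
  rw [h4]
  linarith

/-- A discrete measure with linear growth and controlled energy in a double cone has controlled
total curvature. -/
lemma sum_cauchyPerm_le {s : Finset ℂ} {m : ℂ → ℝ} (hm : ∀ i, 0 ≤ m i) {ε : ℝ} (hε : 0 < ε)
    (hG : ∀ a ∈ s, ∀ r, ε ≤ r → ∑ c ∈ s with ‖a - c‖ ≤ r, m c ≤ r)
    (hS : ∀ a ∈ s, ∀ c ∈ s, a ≠ c → ε ≤ ‖a - c‖) {κ : ℝ} (h0 : 0 < κ) (h1 : κ ≤ 1) {e : ℂ}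
    (he : ‖e‖ = 1) {B : ℝ} (hK : ∑ a ∈ s, ∑ b ∈ s,
      (if (a - b) * e ∈ vertCone κ then m a * m b / ‖a - b‖ else 0) ≤ B * ∑ a ∈ s, m a) :
    ∑ a ∈ s, ∑ b ∈ s, ∑ c ∈ s, m a * m b * m c * cauchyPerm a b c ≤
      5190 / κ ^ 8 * (7 + 8 * B) * ∑ a ∈ s, m a := by
  set X : ℂ → ℂ → ℂ → ℝ := fun a b c => m a * m b * m c *
    (if (a - b) * e ∈ vertCone κ then 1 / (max ‖a - b‖ ‖a - c‖) ^ 2 else 0) with hX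
  have hXle : ∑ a ∈ s, ∑ b ∈ s, ∑ c ∈ s, X a b c ≤ (7 + 8 * B) * ∑ a ∈ s, m a := by
    have hinner : ∀ a ∈ s, ∀ b ∈ s, ∑ c ∈ s, X a b c ≤ (if a = b then 7 * m a else 0) +
        8 * (if (a - b) * e ∈ vertCone κ then m a * m b / ‖a - b‖ else 0) := by
      intro a ha b hb
      have e1 : ∑ c ∈ s, X a b c = m a * m b * (if (a - b) * e ∈ vertCone κ then
          ∑ c ∈ s, m c * (1 / (max ‖a - b‖ ‖a - c‖) ^ 2) else 0) := by
        split_ifs with h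
        · rw [Finset.mul_sum]
          refine Finset.sum_congr rfl fun c _ => ?_
          rw [hX]; simp only [if_pos h]; ring
        · rw [mul_zero]
          refine Finset.sum_eq_zero fun c _ => ?_
          rw [hX]; simp only [if_neg h, mul_zero]
      have hma := hm a
      have hmb := hm b
      rw [e1]
      by_cases hab : a = b
      · subst hab
        have hz : (a - a) * e ∈ vertCone κ := by simp [vertCone]
        rw [if_pos hz, if_pos rfl, if_pos hz]
        have h7 := sum_div_norm_sq_le hm hε (hG a ha) (hS a ha)
        have hma' : m a ≤ ε := by
          refine le_trans ?_ (hG a ha ε le_rfl)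
          exact Finset.single_le_sum (f := m) (fun i _ => hm i)
            (Finset.mem_filter.2 ⟨ha, by simpa using hε.le⟩)
        have h70 : 0 ≤ ∑ c ∈ s, m c / ‖a - c‖ ^ 2 :=
          Finset.sum_nonneg fun c _ => div_nonneg (hm c) (by positivity)
        simp only [sub_self, norm_zero, div_zero, mul_zero, add_zero, mul_one_div,
          max_eq_right (norm_nonneg _)]
        calc m a * m a * ∑ c ∈ s, m c / ‖a - c‖ ^ 2 ≤ m a * ε * (7 / ε) := by gcongr
          _ = 7 * m a := by field_simp
      · rw [if_neg hab, zero_add]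
        split_ifs with h
        · calc m a * m b * ∑ c ∈ s, m c * (1 / (max ‖a - b‖ ‖a - c‖) ^ 2)
              ≤ m a * m b * (8 / ‖a - b‖) := by
                gcongr
                exact sum_div_max_sq_le hm hε (hG a ha) (hS a ha b hb hab)
            _ = _ := by ring
        · simp
    refine (Finset.sum_le_sum fun a ha => Finset.sum_le_sum fun b hb => hinner a ha b hb).trans ?_
    simp only [Finset.sum_add_distrib, ← Finset.mul_sum]
    have : ∑ a ∈ s, ∑ b ∈ s, (if a = b then 7 * m a else 0) = 7 * ∑ a ∈ s, m a := by
      rw [Finset.mul_sum]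
      refine Finset.sum_congr rfl fun a ha => ?_
      rw [Finset.sum_ite_eq, if_pos ha]
    rw [this]
    linarith
  have h2 := sum_rotate s X
  have h3 := sum_rotate s (fun a b c => X b c a)
  have hP := sum_conePerm_nonneg s m hm κ e
  have hle : ∑ a ∈ s, ∑ b ∈ s, ∑ c ∈ s, m a * m b * m c * cauchyPerm a b c ≤
      ∑ a ∈ s, ∑ b ∈ s, ∑ c ∈ s, (-(4 / κ ^ 2) * (m a * m b * m c *
        conePerm κ (a * e) (b * e) (c * e)) + 1730 / κ ^ 8 * (X a b c + X b c a + X c a b)) := by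
    refine Finset.sum_le_sum fun a _ => Finset.sum_le_sum fun b _ => Finset.sum_le_sum fun c _ => ?_
    have := cauchyPerm_le_conePerm_add h0 h1 (a * e) (b * e) (c * e)
    rw [cauchyPerm_mul he] at this
    simp only [← sub_mul, norm_mul, he, mul_one] at this
    have hmm : 0 ≤ m a * m b * m c := mul_nonneg (mul_nonneg (hm a) (hm b)) (hm c)
    refine (mul_le_mul_of_nonneg_left this hmm).trans (le_of_eq ?_)
    rw [hX]; ring
  refine hle.trans ?_
  simp only [Finset.sum_add_distrib, ← Finset.mul_sum]
  have hκ : 0 ≤ 4 / κ ^ 2 := by positivity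
  have hκ8 : 0 ≤ 1730 / κ ^ 8 := by positivity
  have p1 := mul_nonneg hκ hP
  have e2 : ∑ a ∈ s, ∑ b ∈ s, ∑ c ∈ s, X a b c + ∑ a ∈ s, ∑ b ∈ s, ∑ c ∈ s, X b c a +
      ∑ a ∈ s, ∑ b ∈ s, ∑ c ∈ s, X c a b = 3 * ∑ a ∈ s, ∑ b ∈ s, ∑ c ∈ s, X a b c := by linarith
  rw [e2]
  have p2 := mul_le_mul_of_nonneg_left hXle hκ8
  have e3 : 5190 / κ ^ 8 * (7 + 8 * B) * ∑ a ∈ s, m a =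
    3 * (1730 / κ ^ 8 * ((7 + 8 * B) * ∑ a ∈ s, m a)) := by ring
  rw [e3]
  linarith

/-- Restricting to the points of small pointwise curvature keeps half of the mass. -/
lemma exists_subset_curvature_le {s : Finset ℂ} {m : ℂ → ℝ} (hm : ∀ i, 0 ≤ m i) {C : ℝ}
    (hC : 0 < C) (h : ∑ a ∈ s, ∑ b ∈ s, ∑ c ∈ s, m a * m b * m c * cauchyPerm a b c ≤
      C * ∑ a ∈ s, m a) :
    ∃ s' ⊆ s, (∑ a ∈ s, m a) / 2 ≤ ∑ a ∈ s', m a ∧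
      ∀ a ∈ s', ∑ b ∈ s', ∑ c ∈ s', m b * m c * cauchyPerm a b c ≤ 2 * C := by
  set q : ℂ → ℝ := fun a => ∑ b ∈ s, ∑ c ∈ s, m b * m c * cauchyPerm a b c with hq
  have hnn : ∀ a b c, 0 ≤ m b * m c * cauchyPerm a b c := fun a b c =>
    mul_nonneg (mul_nonneg (hm b) (hm c)) (cauchyPerm_nonneg a b c)
  have hq0 : ∀ a, 0 ≤ q a := fun a => Finset.sum_nonneg fun b _ => Finset.sum_nonneg fun c _ =>
    hnn a b c
  have hsum : ∑ a ∈ s, m a * q a ≤ C * ∑ a ∈ s, m a := by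
    refine le_trans (le_of_eq ?_) h
    refine Finset.sum_congr rfl fun a _ => ?_
    rw [hq, Finset.mul_sum]
    refine Finset.sum_congr rfl fun b _ => ?_
    rw [Finset.mul_sum]
    exact Finset.sum_congr rfl fun c _ => by ring
  refine ⟨s.filter fun a => q a ≤ 2 * C, Finset.filter_subset _ _, ?_, ?_⟩
  · have h1 : ∑ a ∈ s with ¬ q a ≤ 2 * C, m a * (2 * C) ≤ ∑ a ∈ s, m a * q a := by
      refine (Finset.sum_le_sum fun a ha => ?_).trans
        (Finset.sum_le_sum_of_subset_of_nonneg (Finset.filter_subset _ _)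
          fun a _ _ => mul_nonneg (hm a) (hq0 a))
      have := (Finset.mem_filter.1 ha).2
      exact mul_le_mul_of_nonneg_left (not_le.1 this).le (hm a)
    have h2 := Finset.sum_filter_add_sum_filter_not s (fun a => q a ≤ 2 * C) m
    rw [← Finset.sum_mul] at h1
    have h3 : C * (2 * ∑ a ∈ s with ¬ q a ≤ 2 * C, m a) ≤ C * ∑ a ∈ s, m a := by linarith
    have h4 := le_of_mul_le_mul_left h3 hC
    linarith
  · intro a ha
    refine le_trans ?_ (Finset.mem_filter.1 ha).2
    refine (Finset.sum_le_sum fun b _ => Finset.sum_le_sum_of_subset_of_nonneg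
      (Finset.filter_subset _ _) fun c _ _ => hnn a b c).trans ?_
    exact Finset.sum_le_sum_of_subset_of_nonneg (Finset.filter_subset _ _)
      fun b _ _ => Finset.sum_nonneg fun c _ => hnn a b c

/-- The Cauchy transform of the discrete measure with weights `w`; at an atom, the principal
value. -/
noncomputable def cauchySum (s : Finset ℂ) (w : ℂ → ℂ) (z : ℂ) : ℂ := ∑ b ∈ s, w b * (z - b)⁻¹

lemma sum_cauchyPerm_eq (s : Finset ℂ) (m : ℂ → ℝ) (a : ℂ) :
    ∑ b ∈ s, ∑ c ∈ s, m b * m c * cauchyPerm a b c =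
      ‖cauchySum s (fun b => m b) a‖ ^ 2 - 2 * (cauchySum s
        (fun b => m b * (starRingEnd ℂ) (cauchySum s (fun b => m b) b)) a).re := by
  set F := cauchySum s (fun b => (m b : ℂ)) with hF
  set W := cauchySum s (fun b => m b * (starRingEnd ℂ) (F b)) with hW
  have h1 : ∑ b ∈ s, ∑ c ∈ s, (m b * m c : ℂ) * ((a - b)⁻¹ * (starRingEnd ℂ) (a - c)⁻¹) =
      F a * (starRingEnd ℂ) (F a) := by
    rw [hF, cauchySum, _root_.map_sum, Finset.sum_mul_sum]
    refine Finset.sum_congr rfl fun b _ => Finset.sum_congr rfl fun c _ => ?_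
    rw [map_mul, Complex.conj_ofReal]; ring
  have h2 : ∑ b ∈ s, ∑ c ∈ s, (m b * m c : ℂ) * ((b - a)⁻¹ * (starRingEnd ℂ) (b - c)⁻¹) =
      - W a := by
    rw [hW, cauchySum, ← Finset.sum_neg_distrib]
    refine Finset.sum_congr rfl fun b _ => ?_
    have : (starRingEnd ℂ) (F b) = ∑ c ∈ s, (m c : ℂ) * (starRingEnd ℂ) (b - c)⁻¹ := by
      rw [hF, cauchySum, _root_.map_sum]
      refine Finset.sum_congr rfl fun c _ => ?_
      rw [map_mul, Complex.conj_ofReal]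
    rw [this, ← neg_sub a b, inv_neg, Finset.mul_sum, Finset.sum_mul, ← Finset.sum_neg_distrib]
    exact Finset.sum_congr rfl fun c _ => by ring
  have h3 : ∑ b ∈ s, ∑ c ∈ s, (m b * m c : ℂ) * ((c - a)⁻¹ * (starRingEnd ℂ) (c - b)⁻¹) =
      - W a := by
    rw [Finset.sum_comm, ← h2]
    exact Finset.sum_congr rfl fun b _ => Finset.sum_congr rfl fun c _ => by ring
  have h4 : ((∑ b ∈ s, ∑ c ∈ s, m b * m c * cauchyPerm a b c : ℝ)) =
      (F a * (starRingEnd ℂ) (F a) + - W a + - W a).re := by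
    rw [← h1]
    nth_rw 1 [← h2]
    rw [← h3]
    simp only [← Finset.sum_add_distrib, ← mul_add, Complex.re_sum]
    refine Finset.sum_congr rfl fun b _ => Finset.sum_congr rfl fun c _ => ?_
    rw [← Complex.ofReal_mul, Complex.re_ofReal_mul, cauchyPerm]
  rw [h4, Complex.mul_conj, Complex.normSq_eq_norm_sq]
  simp only [Complex.add_re, Complex.neg_re, Complex.ofReal_re]
  ring

lemma sum_div_norm_near_le {s : Finset ℂ} {m : ℂ → ℝ} (hm : ∀ i, 0 ≤ m i) {ε : ℝ} (hε : 0 < ε)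
    {a : ℂ} (hG : ∀ r, ε ≤ r → ∑ c ∈ s with ‖a - c‖ ≤ r, m c ≤ r)
    (hS : ∀ c ∈ s, a ≠ c → ε ≤ ‖a - c‖) {d k : ℝ} (hd : ε ≤ d) (hk : 1 ≤ k) :
    ∑ c ∈ s with ‖a - c‖ ≤ k * d, m c * ‖a - c‖⁻¹ ≤ (k + 7) / 2 * √(d / ε) := by
  have hd0 : 0 < d := hε.trans_le hd
  set t := √(d / ε) with ht
  have ht0 : 0 < t := Real.sqrt_pos.2 (by positivity)
  have htt : t ^ 2 = d / ε := Real.sq_sqrt (by positivity)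
  have hpt : ∀ c ∈ s, m c * ‖a - c‖⁻¹ ≤ m c * (t / (2 * d)) + m c / ‖a - c‖ ^ 2 * (ε * t / 2) := by
    intro c _
    have hmc := hm c
    have : ‖a - c‖⁻¹ ≤ t / (2 * d) + 1 / ‖a - c‖ ^ 2 * (ε * t / 2) := by
      rcases (norm_nonneg (a - c)).eq_or_lt with h | h
      · rw [← h]; simp; positivity
      · set x := ‖a - c‖
        have hd' : d = t ^ 2 * ε := by rw [htt]; field_simp
        rw [hd', ← sub_nonneg]
        have : t / (2 * (t ^ 2 * ε)) + 1 / x ^ 2 * (ε * t / 2) - x⁻¹ =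
            (x - ε * t) ^ 2 / (2 * t * ε * x ^ 2) := by
          field_simp; ring
        rw [this]; positivity
    calc m c * ‖a - c‖⁻¹ ≤ m c * (t / (2 * d) + 1 / ‖a - c‖ ^ 2 * (ε * t / 2)) := by gcongr
      _ = _ := by ring
  have h1 : (∑ c ∈ s with ‖a - c‖ ≤ k * d, m c) ≤ k * d := hG _ (by nlinarith)
  have h2 := sum_div_norm_sq_le hm hε hG hS
  calc ∑ c ∈ s with ‖a - c‖ ≤ k * d, m c * ‖a - c‖⁻¹
      ≤ ∑ c ∈ s with ‖a - c‖ ≤ k * d,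
          (m c * (t / (2 * d)) + m c / ‖a - c‖ ^ 2 * (ε * t / 2)) :=
        Finset.sum_le_sum fun c hc => hpt c (Finset.mem_filter.1 hc).1
    _ = (∑ c ∈ s with ‖a - c‖ ≤ k * d, m c) * (t / (2 * d)) +
        (∑ c ∈ s with ‖a - c‖ ≤ k * d, m c / ‖a - c‖ ^ 2) * (ε * t / 2) := by
        rw [Finset.sum_add_distrib, Finset.sum_mul, Finset.sum_mul]
    _ ≤ k * d * (t / (2 * d)) + 7 / ε * (ε * t / 2) := by
        gcongr
        refine le_trans (Finset.sum_le_sum_of_subset_of_nonneg (Finset.filter_subset _ _) ?_) h2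
        intro c _ _
        exact div_nonneg (hm c) (by positivity)
    _ = (k + 7) / 2 * t := by field_simp

/-- Hölder-type estimate at scale `ε` for the principal values at the atoms. -/
lemma norm_cauchySum_sub_le {s : Finset ℂ} {m : ℂ → ℝ} (hm : ∀ i, 0 ≤ m i) {ε : ℝ} (hε : 0 < ε)
    (hG : ∀ a ∈ s, ∀ r, ε ≤ r → ∑ c ∈ s with ‖a - c‖ ≤ r, m c ≤ r)
    (hS : ∀ a ∈ s, ∀ c ∈ s, a ≠ c → ε ≤ ‖a - c‖) {a b : ℂ} (ha : a ∈ s) (hb : b ∈ s) :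
    ‖cauchySum s (fun b => m b) b‖ ≤
      ‖cauchySum s (fun b => m b) a‖ + 17 * √(‖a - b‖ / ε) := by
  by_cases hab : a = b
  · subst hab; simp
  set d := ‖a - b‖ with hd
  have hdε : ε ≤ d := hS a ha b hb hab
  have hd0 : 0 < d := hε.trans_le hdε
  have hba : ‖b - a‖ = d := by rw [hd, norm_sub_rev]
  have hpt : ∀ c ∈ s, m c * ‖(b - c)⁻¹ - (a - c)⁻¹‖ ≤
      (if ‖a - c‖ ≤ 2 * d then m c * ‖a - c‖⁻¹ else 0) +
      (if ‖b - c‖ ≤ 3 * d then m c * ‖b - c‖⁻¹ else 0) +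
      (if 2 * d ≤ ‖a - c‖ then m c / ‖a - c‖ ^ 2 else 0) * (2 * d) := by
    intro c _
    have hmc := hm c
    have t1 : ‖b - c‖ ≤ d + ‖a - c‖ := by
      have := norm_add_le (b - a) (a - c)
      rwa [sub_add_sub_cancel, hba] at this
    have t2 : ‖a - c‖ ≤ d + ‖b - c‖ := by
      have := norm_add_le (a - b) (b - c)
      rwa [sub_add_sub_cancel, ← hd] at this
    have p2 : 0 ≤ (if 2 * d ≤ ‖a - c‖ then m c / ‖a - c‖ ^ 2 else 0) * (2 * d) := by
      split_ifs <;> positivity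
    by_cases h : ‖a - c‖ ≤ 2 * d
    · rw [if_pos h, if_pos (by linarith)]
      have := norm_sub_le (b - c)⁻¹ (a - c)⁻¹
      rw [norm_inv, norm_inv] at this
      have := mul_le_mul_of_nonneg_left this hmc
      linarith
    · rw [if_neg h, if_pos (not_le.1 h).le, zero_add]
      have h' := not_le.1 h
      have p3 : 0 ≤ (if ‖b - c‖ ≤ 3 * d then m c * ‖b - c‖⁻¹ else 0) := by
        split_ifs <;> positivity
      have hac : 0 < ‖a - c‖ := by linarith
      have hbc : ‖a - c‖ / 2 ≤ ‖b - c‖ := by linarith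
      have hbc0 : 0 < ‖b - c‖ := by linarith
      rw [inv_sub_inv (norm_pos_iff.1 hbc0) (norm_pos_iff.1 hac), norm_div, norm_mul,
        sub_sub_sub_cancel_right, ← hd]
      have : d / (‖b - c‖ * ‖a - c‖) ≤ d / (‖a - c‖ / 2 * ‖a - c‖) := by gcongr
      have := mul_le_mul_of_nonneg_left this hmc
      have e : m c * (d / (‖a - c‖ / 2 * ‖a - c‖)) = m c / ‖a - c‖ ^ 2 * (2 * d) := by
        field_simp
      linarith
  have hdiff : ‖cauchySum s (fun b => m b) b - cauchySum s (fun b => m b) a‖ ≤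
      ∑ c ∈ s, m c * ‖(b - c)⁻¹ - (a - c)⁻¹‖ := by
    unfold cauchySum
    rw [← Finset.sum_sub_distrib]
    refine norm_sum_le_of_le _ fun c _ => ?_
    rw [← mul_sub, norm_mul, Complex.norm_real, Real.norm_of_nonneg (hm c)]
  have hsum := hdiff.trans (Finset.sum_le_sum hpt)
  rw [Finset.sum_add_distrib, Finset.sum_add_distrib, ← Finset.sum_mul, ← Finset.sum_filter,
    ← Finset.sum_filter, ← Finset.sum_filter] at hsum
  have b1 := sum_div_norm_near_le hm hε (hG a ha) (hS a ha) hdε (k := 2) (by norm_num)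
  have b2 := sum_div_norm_near_le hm hε (hG b hb) (hS b hb) hdε (k := 3) (by norm_num)
  have b3 := sum_div_sq_le s m (fun c => ‖a - c‖) hm hε (hG a ha) (r := 2 * d) (by linarith)
  have b4 := mul_le_mul_of_nonneg_right b3 (show 0 ≤ 2 * d by linarith)
  rw [div_mul_cancel₀ _ (by positivity)] at b4
  have h1 : 1 ≤ √(d / ε) := Real.one_le_sqrt.2 ((one_le_div hε).2 hdε)
  have := norm_sub_norm_le (cauchySum s (fun b => (m b : ℂ)) b) (cauchySum s (fun b => m b) a)
  linarith

lemma norm_cauchySum_sub_atom_le {s : Finset ℂ} (w : ℂ → ℂ) {ε : ℝ} (hε : 0 < ε) {a : ℂ}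
    (ha : a ∈ s) (hS : ∀ c ∈ s, a ≠ c → ε ≤ ‖a - c‖) {z : ℂ} (hz : ‖z - a‖ = ε / 2) :
    ‖cauchySum s w z - cauchySum s w a‖ ≤
      2 / ε * ‖w a‖ + ∑ b ∈ s, ‖w b‖ * (ε / ‖a - b‖ ^ 2) := by
  have hpt : ∀ b ∈ s, ‖w b * (z - b)⁻¹ - w b * (a - b)⁻¹‖ ≤
      (if a = b then 2 / ε * ‖w a‖ else 0) + ‖w b‖ * (ε / ‖a - b‖ ^ 2) := by
    intro b hb
    by_cases hab : a = b
    · subst hab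
      rw [if_pos rfl, sub_self, inv_zero, mul_zero, sub_zero, norm_mul, norm_inv, hz]
      simp [mul_comm]
    · rw [if_neg hab, zero_add, ← mul_sub, norm_mul]
      have h1 := hS b hb hab
      have h2 : ‖a - b‖ ≤ ε / 2 + ‖z - b‖ := by
        have := norm_add_le (a - z) (z - b)
        rwa [sub_add_sub_cancel, norm_sub_rev a z, hz] at this
      have h3 : ‖a - b‖ / 2 ≤ ‖z - b‖ := by linarith
      have hab0 : 0 < ‖a - b‖ := by linarith
      have hzb0 : 0 < ‖z - b‖ := by linarith
      gcongr
      rw [inv_sub_inv (norm_pos_iff.1 hzb0) (norm_pos_iff.1 hab0), norm_div, norm_mul,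
        sub_sub_sub_cancel_right, norm_sub_rev a z, hz]
      calc ε / 2 / (‖z - b‖ * ‖a - b‖) ≤ ε / 2 / (‖a - b‖ / 2 * ‖a - b‖) := by gcongr
        _ = _ := by field_simp
  unfold cauchySum
  rw [← Finset.sum_sub_distrib]
  refine (norm_sum_le_of_le _ hpt).trans (le_of_eq ?_)
  rw [Finset.sum_add_distrib, Finset.sum_ite_eq, if_pos ha]

/-- Boundary estimate on the circles of radius `ε / 2` around the atoms. -/
lemma cauchySum_boundary_le {s : Finset ℂ} {m : ℂ → ℝ} (hm : ∀ i, 0 ≤ m i) {ε : ℝ} (hε : 0 < ε)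
    (hG : ∀ a ∈ s, ∀ r, ε ≤ r → ∑ c ∈ s with ‖a - c‖ ≤ r, m c ≤ r)
    (hS : ∀ a ∈ s, ∀ c ∈ s, a ≠ c → ε ≤ ‖a - c‖) {B : ℝ}
    (hB : ∀ a ∈ s, ∑ b ∈ s, ∑ c ∈ s, m b * m c * cauchyPerm a b c ≤ B) {a : ℂ} (ha : a ∈ s)
    {z : ℂ} (hz : ‖z - a‖ = ε / 2) :
    ‖cauchySum s (fun b => m b) z‖ ^ 2 / 4 ≤ (cauchySum s
        (fun b => m b * (starRingEnd ℂ) (cauchySum s (fun b => m b) b)) z).re + (322 + B / 2) := by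
  have hq := hB a ha
  rw [sum_cauchyPerm_eq] at hq
  set F := cauchySum s (fun b => (m b : ℂ)) with hF
  set W := cauchySum s (fun b => m b * (starRingEnd ℂ) (F b)) with hW
  have hma : m a ≤ ε := by
    refine le_trans ?_ (hG a ha ε le_rfl)
    exact Finset.single_le_sum (f := m) (fun i _ => hm i)
      (Finset.mem_filter.2 ⟨ha, by simpa using hε.le⟩)
  have h2 := sum_div_norm_sq_le hm hε (hG a ha) (hS a ha)
  have e2 : (∑ b ∈ s, m b / ‖a - b‖ ^ 2) * ε ≤ 7 := by
    have := mul_le_mul_of_nonneg_right h2 hε.le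
    rwa [div_mul_cancel₀ _ hε.ne'] at this
  have hma2 : 2 / ε * m a ≤ 2 := by
    calc 2 / ε * m a ≤ 2 / ε * ε := by gcongr
      _ = 2 := by field_simp
  have hFz : ‖F z - F a‖ ≤ 9 := by
    refine (norm_cauchySum_sub_atom_le _ hε ha (hS a ha) hz).trans ?_
    have : ∑ b ∈ s, ‖(m b : ℂ)‖ * (ε / ‖a - b‖ ^ 2) = (∑ b ∈ s, m b / ‖a - b‖ ^ 2) * ε := by
      rw [Finset.sum_mul]
      refine Finset.sum_congr rfl fun b _ => ?_
      rw [Complex.norm_real, Real.norm_of_nonneg (hm b)]; ring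
    rw [this, Complex.norm_real, Real.norm_of_nonneg (hm a)]
    linarith
  have hWz : ‖W z - W a‖ ≤ 9 * ‖F a‖ + 119 := by
    refine (norm_cauchySum_sub_atom_le _ hε ha (hS a ha) hz).trans ?_
    have hn : ∀ b, ‖(m b : ℂ) * (starRingEnd ℂ) (F b)‖ = m b * ‖F b‖ := by
      intro b
      rw [norm_mul, Complex.norm_real, Real.norm_of_nonneg (hm b), RCLike.norm_conj]
    simp only [hn]
    have h3 := sum_div_mul_sqrt_le s m (fun c => ‖a - c‖) hm hε (hG a ha) le_rfl
    have h3' : (∑ b ∈ s, m b / (‖a - b‖ * √‖a - b‖)) * √ε ≤ 7 := by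
      have e : ∑ b ∈ s, m b / (‖a - b‖ * √‖a - b‖) =
          ∑ b ∈ s with ε ≤ ‖a - b‖, m b / (‖a - b‖ * √‖a - b‖) := by
        symm
        refine Finset.sum_subset (Finset.filter_subset _ _) fun c hc hc' => ?_
        by_cases h : a = c
        · simp [h]
        · exact absurd (Finset.mem_filter.2 ⟨hc, hS a ha c hc h⟩) hc'
      rw [e]
      have := mul_le_mul_of_nonneg_right h3 (Real.sqrt_nonneg ε)
      rwa [div_mul_cancel₀ _ (Real.sqrt_pos.2 hε).ne'] at this
    have h4 : ∑ b ∈ s, m b * ‖F b‖ * (ε / ‖a - b‖ ^ 2) ≤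
        ‖F a‖ * ((∑ b ∈ s, m b / ‖a - b‖ ^ 2) * ε) +
          17 * ((∑ b ∈ s, m b / (‖a - b‖ * √‖a - b‖)) * √ε) := by
      simp only [Finset.sum_mul, Finset.mul_sum, ← Finset.sum_add_distrib]
      refine Finset.sum_le_sum fun b hb => ?_
      have hmb := hm b
      by_cases hab : a = b
      · subst hab; simp
      have hd : 0 < ‖a - b‖ := norm_pos_iff.2 (sub_ne_zero.2 hab)
      calc m b * ‖F b‖ * (ε / ‖a - b‖ ^ 2)
          ≤ m b * (‖F a‖ + 17 * √(‖a - b‖ / ε)) * (ε / ‖a - b‖ ^ 2) := by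
            gcongr
            exact norm_cauchySum_sub_le hm hε hG hS ha hb
        _ = _ := by
            rw [Real.sqrt_div hd.le]
            have e1 := Real.mul_self_sqrt hd.le
            have e3 := Real.mul_self_sqrt hε.le
            have p1 := Real.sqrt_pos.2 hd
            have p2 := Real.sqrt_pos.2 hε
            generalize √‖a - b‖ = x at *
            generalize √ε = y at *
            rw [← e1, ← e3]
            field_simp
    have h5 := mul_le_mul_of_nonneg_left e2 (norm_nonneg (F a))
    have h6 := mul_le_mul_of_nonneg_right hma2 (norm_nonneg (F a))
    rw [← mul_assoc]
    linarith
  have h1 : ‖F z‖ ≤ ‖F a‖ + 9 := by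
    have := norm_sub_norm_le (F z) (F a)
    linarith
  have h3 : (W a).re - (W z).re ≤ 9 * ‖F a‖ + 119 := by
    have := Complex.abs_re_le_norm (W z - W a)
    rw [Complex.sub_re] at this
    linarith [neg_le_of_abs_le this]
  have h4 : ‖F z‖ ^ 2 ≤ (‖F a‖ + 9) ^ 2 := by gcongr
  nlinarith [sq_nonneg (‖F a‖ - 27)]

lemma differentiableAt_cauchySum (s : Finset ℂ) (w : ℂ → ℂ) {z : ℂ} (hz : ∀ a ∈ s, z ≠ a) :
    DifferentiableAt ℂ (cauchySum s w) z := by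
  unfold cauchySum
  refine DifferentiableAt.fun_sum fun a ha => ?_
  have := sub_ne_zero.2 (hz a ha)
  fun_prop (disch := assumption)

lemma tendsto_inv_sub_cocompact (b : ℂ) :
    Tendsto (fun z : ℂ => (z - b)⁻¹) (cocompact ℂ) (𝓝 0) := by
  have : Tendsto (fun z : ℂ => z - b) (cocompact ℂ) (cocompact ℂ) :=
    (Homeomorph.subRight b).isClosedEmbedding.tendsto_cocompact
  exact tendsto_inv₀_cobounded.comp (by rwa [← Metric.cobounded_eq_cocompact] at *)

lemma tendsto_cauchySum (s : Finset ℂ) (w : ℂ → ℂ) :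
    Tendsto (cauchySum s w) (cocompact ℂ) (𝓝 0) := by
  have : Tendsto (fun z => ∑ b ∈ s, w b * (z - b)⁻¹) (cocompact ℂ) (𝓝 (∑ b ∈ s, w b * 0)) :=
    tendsto_finsetSum _ fun b _ => (tendsto_inv_sub_cocompact b).const_mul _
  simp only [mul_zero, Finset.sum_const_zero] at this
  exact this

lemma tendsto_mul_cauchySum (s : Finset ℂ) (w : ℂ → ℂ) :
    Tendsto (fun z => z * cauchySum s w z) (cocompact ℂ) (𝓝 (∑ b ∈ s, w b)) := by
  have h : Tendsto (fun z => ∑ b ∈ s, (w b + w b * b * (z - b)⁻¹)) (cocompact ℂ)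
      (𝓝 (∑ b ∈ s, (w b + w b * b * 0))) :=
    tendsto_finsetSum _ fun b _ => ((tendsto_inv_sub_cocompact b).const_mul _).const_add _
  simp only [mul_zero, add_zero] at h
  refine h.congr' ?_
  have hc : (s : Set ℂ)ᶜ ∈ cocompact ℂ := s.finite_toSet.isCompact.compl_mem_cocompact
  filter_upwards [hc] with z hz
  rw [cauchySum, Finset.mul_sum]
  refine Finset.sum_congr rfl fun b hb => ?_
  have : z - b ≠ 0 := fun h => hz (by rw [sub_eq_zero.1 h]; exact hb)
  field_simp
  ring

/-- A maximum principle: the inequality `‖F‖² / 4 ≤ Re W + C` propagates from the boundary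
circles to the unbounded domain. -/
lemma norm_sq_le_of_boundary {s : Finset ℂ} {ρ : ℝ} (hρ : 0 < ρ) (u w : ℂ → ℂ) {C : ℝ} (hC : 0 < C)
    (hbd : ∀ a ∈ s, ∀ z, ‖z - a‖ = ρ →
      ‖cauchySum s u z‖ ^ 2 / 4 ≤ (cauchySum s w z).re + C)
    {z : ℂ} (hz : ∀ a ∈ s, ρ < ‖z - a‖) :
    ‖cauchySum s u z‖ ^ 2 / 4 ≤ (cauchySum s w z).re + C := by
  set F := cauchySum s u with hF
  set W := cauchySum s w with hW
  set v : ℂ := F z / 2 with hv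
  set H : ℂ → ℂ := fun x => (starRingEnd ℂ) v * F x - W x with hH
  have hH0 : Tendsto H (cocompact ℂ) (𝓝 0) := by
    simpa using ((tendsto_cauchySum s u).const_mul ((starRingEnd ℂ) v)).sub (tendsto_cauchySum s w)
  have hre : Tendsto (fun x => (H x).re) (cocompact ℂ) (𝓝 0) := by
    simpa [Function.comp_def] using (Complex.continuous_re.tendsto 0).comp hH0
  have hev : ∀ᶠ x in cocompact ℂ, (H x).re < C := hre.eventually_lt_const hC
  rw [← Metric.cobounded_eq_cocompact] at hev
  obtain ⟨R, hR⟩ : ∃ R : ℝ, ∀ x : ℂ, R ≤ ‖x‖ → (H x).re < C := by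
    simpa using (hasBasis_cobounded_norm (E := ℂ)).eventually_iff.1 hev
  set R' := max R (‖z‖ + 1)
  set U : Set ℂ := (⋂ a ∈ s, {x | ρ < ‖x - a‖}) ∩ ball 0 R' with hU
  have hUo : IsOpen U := by
    refine IsOpen.inter (isOpen_biInter_finset fun a _ => ?_) isOpen_ball
    exact isOpen_lt continuous_const (by fun_prop)
  have hcl : closure U ⊆ (⋂ a ∈ s, {x | ρ ≤ ‖x - a‖}) ∩ closedBall 0 R' := by
    refine closure_minimal ?_ ?_
    · refine inter_subset_inter (iInter₂_mono fun a _ x hx => ?_) ball_subset_closedBall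
      exact (show ρ < ‖x - a‖ from hx).le
    · refine IsClosed.inter (isClosed_biInter fun a _ => ?_) isClosed_closedBall
      exact isClosed_le continuous_const (by fun_prop)
  have hne : ∀ x ∈ closure U, ∀ a ∈ s, x ≠ a := by
    rintro x hx a ha rfl
    have := mem_iInter₂.1 (hcl hx).1 x ha
    simp only [sub_self, norm_zero, mem_ofPred_eq] at this
    linarith
  have hd : DiffContOnCl ℂ (fun x => Complex.exp (H x)) U := by
    refine DifferentiableOn.diffContOnCl fun x hx => ?_
    refine DifferentiableAt.differentiableWithinAt ?_
    have h1 := differentiableAt_cauchySum s u (hne x hx)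
    have h2 := differentiableAt_cauchySum s w (hne x hx)
    exact ((h1.const_mul _).sub h2).cexp
  have hzU : z ∈ U := by
    refine ⟨mem_iInter₂.2 fun a ha => hz a ha, ?_⟩
    rw [mem_ball_zero_iff]
    exact lt_of_lt_of_le (by linarith) (le_max_right _ _)
  have hmax : ‖Complex.exp (H z)‖ ≤ Real.exp (‖v‖ ^ 2 + C) := by
    refine Complex.norm_le_of_forall_mem_frontier_norm_le (isBounded_ball.subset inter_subset_right)
      hd (fun x hx => ?_) (subset_closure hzU)
    rw [Complex.norm_exp, Real.exp_le_exp]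
    have hxc := hcl (frontier_subset_closure hx)
    by_cases hxR : R' ≤ ‖x‖
    · have := hR x ((le_max_left _ _).trans hxR)
      nlinarith [sq_nonneg ‖v‖]
    · rw [hUo.frontier_eq] at hx
      have hx2 : ∃ a ∈ s, ¬ ρ < ‖x - a‖ := by
        by_contra! h
        exact hx.2 ⟨mem_iInter₂.2 h, by rw [mem_ball_zero_iff]; exact not_le.1 hxR⟩
      obtain ⟨a, ha, hxa⟩ := hx2
      have hxa' : ‖x - a‖ = ρ := le_antisymm (not_lt.1 hxa) (mem_iInter₂.1 hxc.1 a ha)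
      have hb := hbd a ha x hxa'
      have h1 : ((starRingEnd ℂ) v * F x).re ≤ ‖v‖ * ‖F x‖ := by
        refine (Complex.re_le_norm _).trans ?_
        rw [norm_mul, RCLike.norm_conj]
      simp only [hH, Complex.sub_re]
      nlinarith [sq_nonneg (‖v‖ - ‖F x‖ / 2)]
  rw [Complex.norm_exp, Real.exp_le_exp] at hmax
  have e1 : ((starRingEnd ℂ) v * F z).re = ‖F z‖ ^ 2 / 2 := by
    have : (starRingEnd ℂ) v * F z = ((‖F z‖ ^ 2 / 2 : ℝ) : ℂ) := by
      rw [hv, map_div₀, div_mul_eq_mul_div, mul_comm, Complex.mul_conj, Complex.normSq_eq_norm_sq]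
      simp [show (starRingEnd ℂ) 2 = 2 from map_ofNat _ 2]
    rw [this, Complex.ofReal_re]
  have e2 : ‖v‖ ^ 2 = ‖F z‖ ^ 2 / 4 := by
    rw [hv, norm_div]; simp; ring
  simp only [hH, Complex.sub_re, e1, e2] at hmax
  linarith

/-- Construction of a bounded holomorphic function with large derivative at infinity. -/
lemma exists_bounded_holomorphic {s : Finset ℂ} {m : ℂ → ℝ} (hm : ∀ i, 0 ≤ m i) {ε : ℝ}
    (hε : 0 < ε)
    (hG : ∀ a ∈ s, ∀ r, ε ≤ r → ∑ c ∈ s with ‖a - c‖ ≤ r, m c ≤ r)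
    (hS : ∀ a ∈ s, ∀ c ∈ s, a ≠ c → ε ≤ ‖a - c‖) {B : ℝ} (hB0 : 0 ≤ B)
    (hB : ∀ a ∈ s, ∑ b ∈ s, ∑ c ∈ s, m b * m c * cauchyPerm a b c ≤ B) :
    ∃ f : ℂ → ℂ, DifferentiableOn ℂ f {z | ∀ a ∈ s, ε / 2 < ‖z - a‖} ∧
      (∀ z, (∀ a ∈ s, ε / 2 < ‖z - a‖) → ‖f z‖ ≤ 1) ∧
      Tendsto (fun z => z * f z) (cocompact ℂ)
        (𝓝 (((∑ a ∈ s, m a) / (323 + B / 2) : ℝ) : ℂ)) := by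
  set F := cauchySum s (fun b => (m b : ℂ)) with hF
  set W := cauchySum s (fun b => m b * (starRingEnd ℂ) (F b)) with hW
  have hbd : ∀ z, (∀ a ∈ s, ε / 2 < ‖z - a‖) → ‖F z‖ ^ 2 / 4 ≤ (W z).re + (322 + B / 2) :=
    fun z hz => norm_sq_le_of_boundary (half_pos hε) _ _ (by positivity)
      (fun a ha z hz => cauchySum_boundary_le hm hε hG hS hB ha hz) hz
  set C : ℝ := 323 + B / 2 with hC
  have hC0 : C ≠ 0 := by positivity
  have hre : ∀ z, (∀ a ∈ s, ε / 2 < ‖z - a‖) → ‖F z‖ ^ 2 / 4 + 1 ≤ (W z + C).re := by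
    intro z hz
    rw [Complex.add_re, Complex.ofReal_re]
    linarith [hbd z hz]
  have hne : ∀ z, (∀ a ∈ s, ε / 2 < ‖z - a‖) → W z + C ≠ 0 := by
    intro z hz h
    have := hre z hz
    rw [h, Complex.zero_re] at this
    nlinarith [sq_nonneg ‖F z‖]
  refine ⟨fun z => F z / (W z + C), fun z hz => ?_, fun z hz => ?_, ?_⟩
  · have hz' : ∀ a ∈ s, z ≠ a := by
      rintro a ha rfl
      have := hz z ha
      rw [sub_self, norm_zero] at this
      linarith
    have h1 := differentiableAt_cauchySum s (fun b => (m b : ℂ)) hz'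
    have h2 := differentiableAt_cauchySum s (fun b => m b * (starRingEnd ℂ) (F b)) hz'
    exact (h1.div (h2.add_const _) (hne z hz)).differentiableWithinAt
  · have h1 := hre z hz
    have h2 := Complex.re_le_norm (W z + C)
    rw [norm_div]
    refine div_le_one_of_le₀ ?_ (norm_nonneg _)
    nlinarith [sq_nonneg (‖F z‖ - 2)]
  · have h1 := tendsto_mul_cauchySum s (fun b => (m b : ℂ))
    have h2 : Tendsto (fun z => W z + C) (cocompact ℂ) (𝓝 (0 + C)) :=
      (tendsto_cauchySum s _).add_const _
    have h3 := h1.div h2 (by simpa using hC0)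
    rw [zero_add] at h3
    push_cast at h3 ⊢
    refine h3.congr fun z => ?_
    simp only [Pi.div_apply]
    rw [mul_div_assoc]

/-- Lower bound for the bounded holomorphic functions off a small neighbourhood of the atoms of a
discrete measure with linear growth and small energy in a double cone. -/
lemma exists_bounded_holomorphic_of_cone {s : Finset ℂ} {m : ℂ → ℝ} (hm : ∀ i, 0 ≤ m i) {ε : ℝ}
    (hε : 0 < ε)
    (hG : ∀ a ∈ s, ∀ r, ε ≤ r → ∑ c ∈ s with ‖a - c‖ ≤ r, m c ≤ r)
    (hS : ∀ a ∈ s, ∀ c ∈ s, a ≠ c → ε ≤ ‖a - c‖) {κ : ℝ} (h0 : 0 < κ) (h1 : κ ≤ 1) {e : ℂ}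
    (he : ‖e‖ = 1) {B : ℝ} (hB0 : 0 ≤ B) (hK : ∑ a ∈ s, ∑ b ∈ s,
      (if (a - b) * e ∈ vertCone κ then m a * m b / ‖a - b‖ else 0) ≤ B * ∑ a ∈ s, m a) :
    ∃ f : ℂ → ℂ, DifferentiableOn ℂ f {z | ∀ a ∈ s, ε / 2 < ‖z - a‖} ∧
      (∀ z, (∀ a ∈ s, ε / 2 < ‖z - a‖) → ‖f z‖ ≤ 1) ∧
      ∃ d : ℂ, Tendsto (fun z => z * f z) (cocompact ℂ) (𝓝 d) ∧
        (∑ a ∈ s, m a) / (646 + 10380 / κ ^ 8 * (7 + 8 * B)) ≤ ‖d‖ := by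
  set C := 5190 / κ ^ 8 * (7 + 8 * B) with hC
  have hC0 : 0 < C := by positivity
  obtain ⟨s', hs', hmass, hcurv⟩ := exists_subset_curvature_le hm hC0
    (sum_cauchyPerm_le hm hε hG hS h0 h1 he hK)
  obtain ⟨f, hf1, hf2, hf3⟩ := exists_bounded_holomorphic hm hε (s := s')
    (fun a ha r hr => (Finset.sum_le_sum_of_subset_of_nonneg (Finset.filter_subset_filter _ hs')
      fun i _ _ => hm i).trans (hG a (hs' ha) r hr))
    (fun a ha c hc => hS a (hs' ha) c (hs' hc)) (by positivity) hcurv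
  refine ⟨f, hf1.mono fun z hz a ha => hz a (hs' ha), fun z hz => hf2 z fun a ha => hz a (hs' ha),
    _, hf3, ?_⟩
  have hM' : 0 ≤ ∑ a ∈ s', m a := Finset.sum_nonneg fun a _ => hm a
  rw [Complex.norm_real, Real.norm_of_nonneg (by positivity)]
  have e1 : 646 + 10380 / κ ^ 8 * (7 + 8 * B) = 2 * (323 + 2 * C / 2) := by rw [hC]; ring
  rw [e1, ← div_div]
  gcongr

/-- The function `u ↦ f (1 / u)`, with value `w` at the origin. -/
noncomputable def atInfinity (f : ℂ → ℂ) (w u : ℂ) : ℂ := if u = 0 then w else f u⁻¹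

lemma hasDerivAt_atInfinity_iff {f : ℂ → ℂ} {w d : ℂ} :
    HasDerivAt (atInfinity f w) d 0 ↔
      Tendsto (fun z => z * (f z - w)) (cocompact ℂ) (𝓝 d) := by
  rw [hasDerivAt_iff_tendsto_slope_zero, ← Metric.cobounded_eq_cocompact, ← inv_nhdsNE_zero]
  change _ ↔ Tendsto _ (Filter.map _ _) _
  rw [tendsto_map'_iff]
  refine tendsto_congr' ?_
  filter_upwards [self_mem_nhdsWithin] with u hu
  have hu' : u ≠ 0 := hu
  simp [atInfinity, hu']

lemma differentiableOn_atInfinity {f : ℂ → ℂ} {w d : ℂ} {R : ℝ} (hR : 0 < R)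
    (hf : ∀ z, R < ‖z‖ → DifferentiableAt ℂ f z)
    (hd : Tendsto (fun z => z * (f z - w)) (cocompact ℂ) (𝓝 d)) :
    DifferentiableOn ℂ (atInfinity f w) (ball 0 R⁻¹) := by
  intro u hu
  refine DifferentiableAt.differentiableWithinAt ?_
  by_cases h : u = 0
  · rw [h]
    exact (hasDerivAt_atInfinity_iff.2 hd).differentiableAt
  · have hz : R < ‖u⁻¹‖ := by
      rw [mem_ball_zero_iff] at hu
      rw [norm_inv]
      exact (lt_inv_comm₀ (norm_pos_iff.2 h) hR).1 hu
    have h1 : DifferentiableAt ℂ (fun u => f u⁻¹) u :=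
      DifferentiableAt.comp u (hf _ hz) (differentiableAt_inv h)
    refine h1.congr_of_eventuallyEq ?_
    filter_upwards [isOpen_ne.mem_nhds h] with v hv
    have hv' : v ≠ 0 := hv
    simp [atInfinity, hv']

lemma norm_atInfinity_le {f : ℂ → ℂ} {w : ℂ} {R : ℝ} (hR : 0 < R) (hw : ‖w‖ ≤ 1)
    (hf : ∀ z, R < ‖z‖ → ‖f z‖ ≤ 1) {u : ℂ} (hu : u ∈ ball (0 : ℂ) R⁻¹) :
    ‖atInfinity f w u‖ ≤ 1 := by
  unfold atInfinity
  split_ifs with h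
  · exact hw
  · refine hf _ ?_
    rw [mem_ball_zero_iff] at hu
    rw [norm_inv]
    exact (lt_inv_comm₀ (norm_pos_iff.2 h) hR).1 hu

lemma le_analyticCapacity {E : Set ℂ} (hE : IsCompact E) {f : ℂ → ℂ}
    (hf : DifferentiableOn ℂ f Eᶜ) (hf1 : ∀ z ∈ Eᶜ, ‖f z‖ ≤ 1) {w d : ℂ}
    (hw : Tendsto f (cocompact ℂ) (𝓝 w))
    (hd : Tendsto (fun z => z * (f z - w)) (cocompact ℂ) (𝓝 d)) :
    ‖d‖ ≤ analyticCapacity E := by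
  refine le_csSup ?_ ⟨f, hf, hf1, w, d, hw, hd, rfl⟩
  obtain ⟨R, hR0, hR⟩ := hE.isBounded.subset_closedBall_lt 0 0
  have hmem : ∀ z : ℂ, R < ‖z‖ → z ∈ Eᶜ := fun z hz hzE =>
    absurd (mem_closedBall_zero_iff.1 (hR hzE)) (not_le.2 hz)
  refine ⟨2 / R⁻¹, ?_⟩
  rintro c ⟨f, hf, hf1, w, d, hw, hd, rfl⟩
  have hw1 : ‖w‖ ≤ 1 := by
    refine le_of_tendsto hw.norm ?_
    filter_upwards [hE.compl_mem_cocompact] with z hz using hf1 z hz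
  have h1 := differentiableOn_atInfinity hR0
    (fun z hz => hf.differentiableAt (hE.isClosed.isOpen_compl.mem_nhds (hmem z hz))) hd
  have h2 : ∀ u ∈ ball (0 : ℂ) R⁻¹, ‖atInfinity f w u‖ ≤ 1 :=
    fun u hu => norm_atInfinity_le hR0 hw1 (fun z hz => hf1 z (hmem z hz)) hu
  rw [← (hasDerivAt_atInfinity_iff.2 hd).deriv]
  refine Complex.norm_deriv_le_div_of_mapsTo_ball h1 (fun u hu => ?_) (inv_pos.2 hR0)
  rw [mem_closedBall, dist_eq_norm]
  have h3 := h2 u hu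
  have h4 := h2 0 (mem_ball_self (inv_pos.2 hR0))
  exact (norm_sub_le _ _).trans (by linarith)

/-- Pointwise limits of uniformly bounded holomorphic functions along a filter are holomorphic,
and the derivatives converge. -/
lemma differentiableAt_of_pointwise_tendsto {ι : Type*} {l : Filter ι} [l.NeBot]
    {F : ι → ℂ → ℂ} {g : ℂ → ℂ} {x : ℂ} {r : ℝ} (hr : 0 < r)
    (hd : ∀ᶠ n in l, DifferentiableOn ℂ (F n) (ball x r) ∧ ∀ z ∈ ball x r, ‖F n z‖ ≤ 1)
    (hg : ∀ z ∈ ball x r, Tendsto (fun n => F n z) l (𝓝 (g z))) :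
    DifferentiableAt ℂ g x ∧ Tendsto (fun n => deriv (F n) x) l (𝓝 (deriv g x)) := by
  set V := ball x (r / 2)
  have hV : V ⊆ ball x r := ball_subset_ball (by linarith)
  have hlip : ∀ᶠ n in l, ∀ y ∈ V, ∀ w ∈ V, dist y w < r / 2 →
      dist (F n y) (F n w) ≤ 2 / (r / 2) * dist y w := by
    filter_upwards [hd] with n hn y hy w hw hyw
    have hsub : ball w (r / 2) ⊆ ball x r := by
      refine ball_subset_ball' ?_
      have := mem_ball.1 hw
      linarith
    refine Complex.dist_le_div_mul_dist_of_mapsTo_ball (hn.1.mono hsub) (fun z hz => ?_) hyw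
    rw [mem_closedBall, dist_eq_norm]
    exact (norm_sub_le _ _).trans (by linarith [hn.2 z (hsub hz), hn.2 w (hV hw)])
  have hlipg : ∀ y ∈ V, ∀ w ∈ V, dist y w < r / 2 → dist (g y) (g w) ≤ 2 / (r / 2) * dist y w := by
    intro y hy w hw hyw
    refine le_of_tendsto ((hg y (hV hy)).dist (hg w (hV hw))) ?_
    filter_upwards [hlip] with n hn using hn y hy w hw hyw
  have hunif : TendstoUniformlyOn F g l V := by
    rw [Metric.tendstoUniformlyOn_iff]
    intro e he
    set δ := min (r / 2) (e * r / 12) with hδ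
    have hδ0 : 0 < δ := by positivity
    have htb : TotallyBounded V := 
      (isCompact_closedBall x (r / 2)).totallyBounded.subset ball_subset_closedBall
    obtain ⟨t, htV, htf, ht⟩ := Metric.finite_approx_of_totallyBounded htb δ hδ0
    have hfin : ∀ᶠ n in l, ∀ p ∈ t, dist (g p) (F n p) < e / 3 := by
      rw [htf.eventually_all]
      intro p hp
      have := Metric.tendsto_nhds.1 (hg p (hV (htV hp))) (e / 3) (by positivity)
      filter_upwards [this] with n hn
      rwa [dist_comm]
    filter_upwards [hlip, hfin] with n h1 h2 y hy
    obtain ⟨p, hp, hyp⟩ := mem_iUnion₂.1 (ht hy)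
    have hyp' : dist y p < δ := hyp
    have hyp2 : dist y p < r / 2 := hyp'.trans_le (min_le_left _ _)
    have hb : 2 / (r / 2) * dist y p ≤ e / 3 := by
      have : dist y p ≤ e * r / 12 := hyp'.le.trans (min_le_right _ _)
      calc 2 / (r / 2) * dist y p ≤ 2 / (r / 2) * (e * r / 12) := by gcongr
        _ = e / 3 := by field_simp; norm_num
    have e1 := hlipg y hy p (htV hp) hyp2
    have e2 := h1 y hy p (htV hp) hyp2
    have e3 := h2 p hp
    have t1 := dist_triangle (g y) (g p) (F n y)
    have t2 := dist_triangle (g p) (F n p) (F n y)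
    rw [dist_comm (F n p)] at t2
    linarith
  have hloc := hunif.tendstoLocallyUniformlyOn
  have hdV : ∀ᶠ n in l, DifferentiableOn ℂ (F n) V := hd.mono fun n hn => hn.1.mono hV
  have hx : x ∈ V := mem_ball_self (by positivity)
  exact ⟨(hloc.differentiableOn hdV isOpen_ball).differentiableAt (isOpen_ball.mem_nhds hx),
    (hloc.deriv hdV isOpen_ball).tendsto_at hx⟩

/-- Outer regularity: analytic capacity is controlled from below by bounded holomorphic functions
defined off arbitrarily small neighbourhoods of the set. -/
lemma le_analyticCapacity_of_forall_nhds {E : Set ℂ} (hE : IsCompact E) {d₀ : ℝ}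
    (h : ∀ δ > 0, ∃ f : ℂ → ℂ, DifferentiableOn ℂ f {z | ∀ y ∈ E, δ < ‖z - y‖} ∧
      (∀ z, (∀ y ∈ E, δ < ‖z - y‖) → ‖f z‖ ≤ 1) ∧
      ∃ d : ℂ, Tendsto (fun z => z * f z) (cocompact ℂ) (𝓝 d) ∧ d₀ ≤ ‖d‖) :
    d₀ ≤ analyticCapacity E := by
  choose! f hf hf1 d hd hd0 using h
  set δ : ℕ → ℝ := fun n => 1 / (n + 1) with hδ
  have hδ0 : ∀ n, 0 < δ n := fun n => by positivity
  have hδlim : Tendsto δ (hyperfilter ℕ) (𝓝 0) :=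
    tendsto_one_div_add_atTop_nhds_zero_nat.mono_left Nat.hyperfilter_le_atTop
  obtain ⟨R, hR0, hR⟩ := hE.isBounded.subset_closedBall_lt 0 0
  have hball : ∀ z ∈ Eᶜ, ∃ r > 0, ball z r ⊆ Eᶜ ∧ ∀ᶠ n in (hyperfilter ℕ : Filter ℕ),
      ∀ w ∈ ball z r, ∀ y ∈ E, δ n < ‖w - y‖ := by
    intro z hz
    obtain ⟨r, hr, hrE⟩ := Metric.isOpen_iff.1 hE.isClosed.isOpen_compl z hz
    refine ⟨r / 2, half_pos hr, (ball_subset_ball (by linarith)).trans hrE, ?_⟩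
    filter_upwards [hδlim.eventually_lt_const (half_pos hr)] with n hn w hw y hy
    have h1 : r ≤ dist y z := by
      by_contra hlt
      exact hrE (mem_ball.2 (not_le.1 hlt)) hy
    have h2 := dist_triangle y w z
    have h3 := mem_ball.1 hw
    rw [dist_comm y w, dist_eq_norm w y] at h2
    linarith
  have hδ1 : ∀ n, δ n ≤ 1 := fun n => by
    rw [hδ]
    exact div_le_one_of_le₀ (by linarith [n.cast_nonneg (α := ℝ)]) (by positivity)
  have hfar : ∀ n, ∀ z : ℂ, R + 1 < ‖z‖ → ∀ y ∈ E, δ n < ‖z - y‖ := by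
    intro n z hz y hy
    have h1 := mem_closedBall_zero_iff.1 (hR hy)
    have h2 := norm_sub_norm_le z y
    linarith [hδ1 n]
  have hlim : ∀ z ∈ Eᶜ, ∃ c, ‖c‖ ≤ 1 ∧ Tendsto (fun n => f (δ n) z) (hyperfilter ℕ) (𝓝 c) := by
    intro z hz
    obtain ⟨r, hr, -, hev⟩ := hball z hz
    have : ((hyperfilter ℕ).map (fun n => f (δ n) z) : Filter ℂ) ≤ 𝓟 (closedBall 0 1) := by
      rw [le_principal_iff]
      change ∀ᶠ n in (hyperfilter ℕ : Filter ℕ), f (δ n) z ∈ closedBall (0 : ℂ) 1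
      filter_upwards [hev] with n hn
      rw [mem_closedBall_zero_iff]
      exact hf1 _ (hδ0 n) z (hn z (mem_ball_self hr))
    obtain ⟨c, hc, hle⟩ := (isCompact_closedBall (0 : ℂ) 1).ultrafilter_le_nhds _ this
    exact ⟨c, mem_closedBall_zero_iff.1 hc, hle⟩
  choose! g hg1 hg using hlim
  have hgd : DifferentiableOn ℂ g Eᶜ := by
    intro z hz
    obtain ⟨r, hr, hrE, hev⟩ := hball z hz
    refine (differentiableAt_of_pointwise_tendsto (l := hyperfilter ℕ)
      (F := fun n => f (δ n)) hr ?_ fun w hw => hg w (hrE hw)).1.differentiableWithinAt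
    filter_upwards [hev] with n hn
    exact ⟨(hf _ (hδ0 n)).mono fun w hw => hn w hw, fun w hw => hf1 _ (hδ0 n) w (hn w hw)⟩
  have hR1 : 0 < R + 1 := by linarith
  have hd' : ∀ n, Tendsto (fun z => z * (f (δ n) z - 0)) (cocompact ℂ) (𝓝 (d (δ n))) := by
    intro n
    simpa using hd _ (hδ0 n)
  have hopen : IsOpen {z : ℂ | R + 1 < ‖z‖} := isOpen_lt continuous_const continuous_norm
  have hinf := differentiableAt_of_pointwise_tendsto (l := hyperfilter ℕ)
    (F := fun n => atInfinity (f (δ n)) 0) (g := atInfinity g 0) (inv_pos.2 hR1)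
    (Eventually.of_forall fun n =>
      ⟨differentiableOn_atInfinity hR1 (fun z hz => (hf _ (hδ0 n)).differentiableAt
        (mem_of_superset (hopen.mem_nhds hz) fun w hw => hfar n w hw)) (hd' n),
        fun u hu => norm_atInfinity_le hR1 (by simp)
          (fun z hz => hf1 _ (hδ0 n) z (hfar n z hz)) hu⟩)
    (fun u hu => by
      unfold atInfinity
      split_ifs with h
      · exact tendsto_const_nhds
      · refine hg _ fun hE' => ?_
        rw [mem_ball_zero_iff] at hu
        have h1 := mem_closedBall_zero_iff.1 (hR hE')
        rw [norm_inv] at h1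
        have := (lt_inv_comm₀ (norm_pos_iff.2 h) hR1).1 hu
        linarith)
  have hD := hasDerivAt_atInfinity_iff.1 hinf.1.hasDerivAt
  have hnorm : d₀ ≤ ‖deriv (atInfinity g 0) 0‖ := by
    refine ge_of_tendsto hinf.2.norm (Eventually.of_forall fun n => ?_)
    rw [(hasDerivAt_atInfinity_iff.2 (hd' n)).deriv]
    exact hd0 _ (hδ0 n)
  refine hnorm.trans (le_analyticCapacity hE hgd hg1 (w := 0) ?_ hD)
  have h1 : Tendsto (fun z : ℂ => z⁻¹) (cocompact ℂ) (𝓝 0) := by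
    simpa using tendsto_inv_sub_cocompact 0
  have h2 := h1.mul hD
  rw [zero_mul] at h2
  refine h2.congr' ?_
  filter_upwards [(isCompact_singleton (x := (0 : ℂ))).compl_mem_cocompact] with z hz
  have hz' : z ≠ 0 := hz
  field_simp
  ring

/-- A compact set has a finite `ε`-separated `ε`-net. -/
lemma exists_separated_net {E : Set ℂ} (hE : IsCompact E) {ε : ℝ} (hε : 0 < ε) :
    ∃ s : Finset ℂ, ↑s ⊆ E ∧ (∀ a ∈ s, ∀ c ∈ s, a ≠ c → ε ≤ ‖a - c‖) ∧
      E ⊆ ⋃ a ∈ s, closedBall a ε := by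
  lift ε to NNReal using hε.le
  have hε0 : ε / 2 ≠ 0 := by
    have : ε ≠ 0 := fun h => by simp [h] at hε
    positivity
  obtain ⟨N, -, hNf, hN⟩ := exists_finite_isCover_of_isCompact hε0 hE
  have htop : packingNumber ε E ≠ ⊤ := by
    have h1 := packingNumber_two_mul_le_externalCoveringNumber (ε / 2) E
    rw [mul_div_cancel₀ _ two_ne_zero] at h1
    exact ne_top_of_le_ne_top hNf.encard_lt_top.ne
      (h1.trans hN.externalCoveringNumber_le_encard)
  have hfin : (maximalSeparatedSet ε E).Finite := by
    rw [← Set.encard_ne_top_iff, encard_maximalSeparatedSet htop]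
    exact htop
  refine ⟨hfin.toFinset, ?_, ?_, ?_⟩
  · rw [hfin.coe_toFinset]
    exact maximalSeparatedSet_subset
  · intro a ha c hc hac
    have h : (ε : ℝ≥0∞) < edist a c :=
      isSeparated_maximalSeparatedSet (hfin.mem_toFinset.1 ha) (hfin.mem_toFinset.1 hc) hac
    rw [edist_nndist, ENNReal.coe_lt_coe] at h
    rw [← dist_eq_norm, ← coe_nndist]
    exact_mod_cast h.le
  · have h := isCover_iff_subset_iUnion_closedBall.1 (isCover_maximalSeparatedSet htop)
    simpa using h

/-- Disjoint measurable cells around the points of a finite set, covering the union of the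
balls. -/
lemma exists_disjoint_cells (s : Finset ℂ) (ε : ℝ) :
    ∃ V : ℂ → Set ℂ, (∀ a, MeasurableSet (V a)) ∧ (∀ a, V a ⊆ closedBall a ε) ∧
      (s : Set ℂ).PairwiseDisjoint V ∧ ⋃ a ∈ s, closedBall a ε ⊆ ⋃ a ∈ s, V a := by
  induction s using Finset.induction_on with
  | empty => exact ⟨fun _ => ∅, by simp, by simp, by simp, by simp⟩
  | insert b s hb ih =>
    obtain ⟨V, hVm, hVs, hVd, hVc⟩ := ih
    have hU : MeasurableSet (⋃ a ∈ s, V a) := s.measurableSet_biUnion fun a _ => hVm a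
    have hne : ∀ a ∈ s, a ≠ b := fun a ha h => hb (h ▸ ha)
    have hup : ∀ a ∈ s, Function.update V b (closedBall b ε \ ⋃ a ∈ s, V a) a = V a :=
      fun a ha => Function.update_of_ne (hne a ha) _ _
    refine ⟨Function.update V b (closedBall b ε \ ⋃ a ∈ s, V a), fun a => ?_, fun a => ?_, ?_, ?_⟩
    · by_cases h : a = b
      · subst h
        simpa using measurableSet_closedBall.diff hU
      · simpa [h] using hVm a
    · by_cases h : a = b
      · subst h
        simp
      · simpa [h] using hVs a
    · rw [Finset.coe_insert, Set.pairwiseDisjoint_insert]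
      refine ⟨fun a ha c hc hac => ?_, fun a ha hab => ?_⟩
      · have := hVd ha hc hac
        simp only [Function.onFun] at this ⊢
        rwa [hup a ha, hup c hc]
      · rw [hup a ha, Function.update_self]
        exact disjoint_sdiff_left.mono_right (subset_biUnion_of_mem (u := V) ha)
    · rw [Finset.set_biUnion_insert, Finset.set_biUnion_insert, Function.update_self]
      have h1 : ⋃ a ∈ s, Function.update V b (closedBall b ε \ ⋃ a ∈ s, V a) a = ⋃ a ∈ s, V a :=
        iUnion₂_congr hup
      rw [h1, sdiff_union_self]
      exact union_subset_union_right _ hVc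

lemma measurable_projCoord (θ : ℝ) : Measurable (projCoord θ) :=
  (Complex.continuous_re.comp (continuous_id.mul continuous_const)).measurable

lemma projCoord_sub (θ : ℝ) (z w : ℂ) : projCoord θ (z - w) = projCoord θ z - projCoord θ w := by
  simp only [projCoord, sub_mul, Complex.sub_re]

lemma norm_exp_neg_mul_I (θ : ℝ) : ‖Complex.exp (-(θ : ℂ) * Complex.I)‖ = 1 := by
  rw [← Complex.ofReal_neg]
  exact Complex.norm_exp_ofReal_mul_I _

lemma abs_projCoord_le (θ : ℝ) (z : ℂ) : |projCoord θ z| ≤ ‖z‖ := by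
  refine (Complex.abs_re_le_norm _).trans ?_
  rw [norm_mul, norm_exp_neg_mul_I, mul_one]

lemma abs_projCoord_sub_projCoord_le (θ φ : ℝ) (z : ℂ) :
    |projCoord θ z - projCoord φ z| ≤ ‖z‖ * |θ - φ| := by
  have h : projCoord θ z - projCoord φ z =
      (z * Complex.exp (-(φ : ℂ) * Complex.I) *
        (Complex.exp (Complex.I * ((φ - θ : ℝ) : ℂ)) - 1)).re := by
    rw [projCoord, projCoord, ← Complex.sub_re]
    congr 1
    rw [mul_sub, mul_assoc z, ← Complex.exp_add, mul_one]
    congr 3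
    push_cast
    ring_nf
  rw [h]
  refine (Complex.abs_re_le_norm _).trans ?_
  rw [norm_mul, norm_mul, norm_exp_neg_mul_I, mul_one]
  gcongr
  refine Real.norm_exp_I_mul_ofReal_sub_one_le.trans ?_
  rw [Real.norm_eq_abs, abs_sub_comm]

lemma abs_arctan_le_abs (t : ℝ) : |Real.arctan t| ≤ |t| := by
  have key : ∀ u : ℝ, 0 ≤ u → Real.arctan u ≤ u := fun u hu => by
    have := Real.le_tan (Real.arctan_nonneg.2 hu) (Real.arctan_lt_pi_div_two u)
    rwa [Real.tan_arctan] at this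
  rcases le_total 0 t with h | h
  · rw [abs_of_nonneg h, abs_of_nonneg (Real.arctan_nonneg.2 h)]
    exact key t h
  · have := key (-t) (by linarith)
    rw [Real.arctan_neg] at this
    have h0 : Real.arctan t ≤ 0 := Real.arctan_zero ▸ Real.arctan_mono h
    rw [abs_of_nonpos h, abs_of_nonpos h0]
    exact this

/-- A vector in a vertical cone has small projections for a large set of directions. -/
lemma exists_directions_of_mem_vertCone {θ η ε : ℝ} (hη : 0 < η) (hη1 : η ≤ 1) (hε : 0 < ε)
    {v : ℂ} (hv : ε ≤ ‖v‖)
    (hc : v * Complex.exp (-(θ : ℂ) * Complex.I) ∈ vertCone (η / 2)) :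
    ∃ S ⊆ Icc (θ - η) (θ + η), MeasurableSet S ∧ ENNReal.ofReal (η * ε / ‖v‖) ≤ volume S ∧
      ∀ φ ∈ S, |projCoord φ v| ≤ ε := by
  have hv0 : 0 < ‖v‖ := hε.trans_le hv
  set u := v * Complex.exp (-(θ : ℂ) * Complex.I) with hu
  have hc' : |u.re| ≤ η / 2 * |u.im| := hc
  have hnu : ‖u‖ = ‖v‖ := by rw [hu, norm_mul, norm_exp_neg_mul_I, mul_one]
  have him : u.im ≠ 0 := by
    intro h
    rw [h, abs_zero, mul_zero] at hc'
    have h0 : u = 0 := Complex.ext (abs_nonpos_iff.1 hc') h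
    rw [h0, norm_zero] at hnu
    exact hv0.ne hnu
  set τ := -Real.arctan (u.re / u.im) with hτ
  have hτ1 : |τ| ≤ η / 2 := by
    rw [hτ, abs_neg]
    refine (abs_arctan_le_abs _).trans ?_
    rw [abs_div, div_le_iff₀ (abs_pos.2 him)]
    exact hc'
  have hz : projCoord (θ + τ) v = 0 := by
    have h1 : projCoord (θ + τ) v = (u * Complex.exp (((-τ : ℝ) : ℂ) * Complex.I)).re := by
      rw [projCoord, hu, mul_assoc, ← Complex.exp_add]
      congr 3
      push_cast
      ring
    rw [h1, Complex.mul_re, Complex.exp_ofReal_mul_I_re, Complex.exp_ofReal_mul_I_im, hτ, neg_neg,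
      Real.sin_arctan, Real.cos_arctan]
    field_simp
    ring
  set ρ := η / 2 * (ε / ‖v‖) with hρ
  have hρ1 : ρ ≤ η / 2 := mul_le_of_le_one_right (by positivity) ((div_le_one hv0).2 hv)
  have hρ2 : ρ ≤ ε / ‖v‖ := mul_le_of_le_one_left (by positivity) (by linarith)
  refine ⟨Icc (θ + τ - ρ) (θ + τ + ρ), ?_, measurableSet_Icc, ?_, fun φ hφ => ?_⟩
  · have := abs_le.1 hτ1
    exact Icc_subset_Icc (by linarith) (by linarith)
  · rw [Real.volume_Icc]
    refine ENNReal.ofReal_le_ofReal (le_of_eq ?_)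
    rw [hρ]
    ring
  · have h1 := abs_projCoord_sub_projCoord_le φ (θ + τ) v
    rw [hz, sub_zero] at h1
    have h2 : |φ - (θ + τ)| ≤ ε / ‖v‖ :=
      (abs_le.2 ⟨by linarith [hφ.1], by linarith [hφ.2]⟩).trans hρ2
    calc _ ≤ ‖v‖ * (ε / ‖v‖) := h1.trans (by gcongr)
      _ = ε := by field_simp

/-- The square integral of the density controls the energy near the diagonal. -/
lemma prod_diagonal_le_lintegral_sq {p : ℝ → ℝ≥0∞} (hp : Measurable p) [SFinite (volume.withDensity p)]
    {δ : ℝ} (hδ : 0 ≤ δ) :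
    ((volume.withDensity p).prod (volume.withDensity p)) {z | |z.1 - z.2| ≤ δ} ≤
      ENNReal.ofReal (4 * δ) * ∫⁻ r, p r ^ 2 := by
  have hm : MeasurableSet {z : ℝ × ℝ | |z.1 - z.2| ≤ δ} :=
    measurableSet_le (measurable_fst.sub measurable_snd).abs measurable_const
  set K : ℝ → ℝ → ℝ≥0∞ := fun t u => {z : ℝ × ℝ | |z.1 - z.2| ≤ δ}.indicator 1 (t, u) with hK
  have hKm : Measurable (Function.uncurry K) := measurable_one.indicator hm
  have hKt : ∀ t, Measurable (K t) := fun t => hKm.comp measurable_prodMk_left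
  have hKs : ∀ t u, K t u = K u t := fun t u => by
    simp only [hK, indicator_apply, mem_ofPred_eq, abs_sub_comm t u, Pi.one_apply]
  have hKi : ∀ t, ∫⁻ u, K t u = ENNReal.ofReal (2 * δ) := fun t => by
    have : ∀ u, K t u = (Icc (t - δ) (t + δ)).indicator 1 u := fun u => by
      simp only [hK, indicator_apply, mem_ofPred_eq, mem_Icc, abs_le]
      congr 1
      exact propext ⟨fun h => ⟨by linarith [h.2], by linarith [h.1]⟩,
        fun h => ⟨by linarith [h.2], by linarith [h.1]⟩⟩
    simp_rw [this]
    rw [lintegral_indicator_one measurableSet_Icc, Real.volume_Icc]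
    congr 1
    ring
  have hI : ∫⁻ t, ∫⁻ u, p t ^ 2 * K t u = ENNReal.ofReal (2 * δ) * ∫⁻ r, p r ^ 2 := by
    have : ∀ t, ∫⁻ u, p t ^ 2 * K t u = ENNReal.ofReal (2 * δ) * p t ^ 2 := fun t => by
      rw [lintegral_const_mul _ (hKt t), hKi, mul_comm]
    simp_rw [this]
    rw [lintegral_const_mul _ (hp.pow_const 2)]
  have hI' : ∫⁻ t, ∫⁻ u, p u ^ 2 * K t u = ENNReal.ofReal (2 * δ) * ∫⁻ r, p r ^ 2 := by
    rw [lintegral_lintegral_swap, ← hI]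
    · simp_rw [hKs]
    · exact (((hp.comp measurable_snd).pow_const 2).mul hKm).aemeasurable
  have hsq : ∀ x y : ℝ≥0∞, x * y ≤ x ^ 2 + y ^ 2 := fun x y => by
    rcases le_total x y with h | h
    · exact (mul_le_mul_left h y).trans (by rw [sq y]; exact le_add_self)
    · exact (mul_le_mul_right h x).trans (by rw [sq x]; exact le_self_add)
  calc ((volume.withDensity p).prod (volume.withDensity p)) {z | |z.1 - z.2| ≤ δ}
      = ∫⁻ t, ∫⁻ u, p t * (p u * K t u) := by
        rw [Measure.prod_apply hm, lintegral_withDensity_eq_lintegral_mul _ hp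
          (measurable_measure_prodMk_left hm)]
        refine lintegral_congr fun t => ?_
        rw [Pi.mul_apply, withDensity_apply _ (measurable_prodMk_left hm),
          ← lintegral_indicator (measurable_prodMk_left hm), ← lintegral_const_mul _
            (hp.indicator (measurable_prodMk_left hm))]
        refine lintegral_congr fun u => ?_
        congr 1
        simp only [hK, indicator_apply, mem_preimage, Pi.one_apply]
        split_ifs <;> simp
    _ ≤ ∫⁻ t, ∫⁻ u, (p t ^ 2 * K t u + p u ^ 2 * K t u) := by
        refine lintegral_mono fun t => lintegral_mono fun u => ?_
        change p t * (p u * K t u) ≤ p t ^ 2 * K t u + p u ^ 2 * K t u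
        rw [← mul_assoc, ← add_mul]
        gcongr
        exact hsq _ _
    _ = ENNReal.ofReal (4 * δ) * ∫⁻ r, p r ^ 2 := by
        have h1 : ∀ t, ∫⁻ u, (p t ^ 2 * K t u + p u ^ 2 * K t u) =
            (∫⁻ u, p t ^ 2 * K t u) + ∫⁻ u, p u ^ 2 * K t u := fun t =>
          lintegral_add_left ((hKt t).const_mul _) _
        simp_rw [h1]
        have h2 : Measurable fun t => ∫⁻ u, p t ^ 2 * K t u :=
          Measurable.lintegral_prod_right' (f := fun z : ℝ × ℝ => p z.1 ^ 2 * K z.1 z.2)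
            (((hp.comp measurable_fst).pow_const 2).mul hKm)
        rw [lintegral_add_left h2, hI, hI', ← add_mul, ← ENNReal.ofReal_add (by positivity)
          (by positivity)]
        congr 2
        ring

lemma prod_strip_le (μ : Measure ℂ) [IsFiniteMeasure μ] (θ : ℝ) {δ : ℝ} (hδ : 0 < δ) :
    (μ.prod μ) {z | |projCoord θ z.1 - projCoord θ z.2| ≤ δ} ≤
      ENNReal.ofReal (4 * δ) * projL2sq θ μ := by
  unfold projL2sq
  split_ifs with h
  · have hP := measurable_projCoord θ
    have hm : MeasurableSet {z : ℝ × ℝ | |z.1 - z.2| ≤ δ} :=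
      measurableSet_le (measurable_fst.sub measurable_snd).abs measurable_const
    have h1 := withDensity_rnDeriv_eq _ _ h
    have : SFinite (volume.withDensity ((μ.map (projCoord θ)).rnDeriv volume)) := by
      rw [h1]
      infer_instance
    have h2 := prod_diagonal_le_lintegral_sq
      (measurable_rnDeriv (μ.map (projCoord θ)) volume) hδ.le
    rw [h1, Measure.map_prod_map _ _ hP hP, Measure.map_apply (hP.prodMap hP) hm] at h2
    exact h2
  · rw [ENNReal.mul_top (by simpa using hδ)]
    exact le_top

/-- A measure with square integrable projection has a large piece satisfying a linear growth
condition in strips. -/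
lemma exists_strip_growth {μ : Measure ℂ} [IsFiniteMeasure μ] {θ q l : ℝ} (hl : 0 < l)
    (hq : projL2sq θ μ ≤ ENNReal.ofReal q) :
    ∃ G, MeasurableSet G ∧ μ Gᶜ ≤ ENNReal.ofReal (q / l) ∧
      ∀ t r, μ (G ∩ {z | |projCoord θ z - t| ≤ r}) ≤ ENNReal.ofReal (2 * r * l) := by
  have hP := measurable_projCoord θ
  unfold projL2sq at hq
  split_ifs at hq with h
  swap
  · simp at hq
  set ν := μ.map (projCoord θ) with hν
  set p := ν.rnDeriv volume with hp
  have hpm : Measurable p := measurable_rnDeriv _ _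
  have hνp : volume.withDensity p = ν := withDensity_rnDeriv_eq _ _ h
  have hl' : ENNReal.ofReal l ≠ 0 := by simpa using hl
  have hG : MeasurableSet {t | p t ≤ ENNReal.ofReal l} := measurableSet_le hpm measurable_const
  refine ⟨projCoord θ ⁻¹' {t | p t ≤ ENNReal.ofReal l}, hP hG, ?_, fun t r => ?_⟩
  · rw [← preimage_compl, ← Measure.map_apply hP hG.compl, ← hν, ← hνp,
      withDensity_apply _ hG.compl, ENNReal.ofReal_div_of_pos hl,
      ENNReal.le_div_iff_mul_le (Or.inl hl') (Or.inl ENNReal.ofReal_ne_top), mul_comm,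
      ← lintegral_const_mul _ hpm]
    refine le_trans ?_ hq
    refine le_trans ?_ (setLIntegral_le_lintegral {t | p t ≤ ENNReal.ofReal l}ᶜ _)
    refine setLIntegral_mono (hpm.pow_const 2) fun x hx => ?_
    rw [sq]
    gcongr
    exact (not_le.1 (show ¬ p x ≤ ENNReal.ofReal l from hx)).le
  · have hS : MeasurableSet (Icc (t - r) (t + r)) := measurableSet_Icc
    have h1 : projCoord θ ⁻¹' {t | p t ≤ ENNReal.ofReal l} ∩ {z | |projCoord θ z - t| ≤ r} =
        projCoord θ ⁻¹' ({t | p t ≤ ENNReal.ofReal l} ∩ Icc (t - r) (t + r)) := by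
      ext z
      simp only [mem_inter_iff, mem_preimage, mem_ofPred_eq, mem_Icc, abs_le]
      exact and_congr_right fun _ => ⟨fun h => ⟨by linarith [h.1], by linarith [h.2]⟩,
        fun h => ⟨by linarith [h.1], by linarith [h.2]⟩⟩
    rw [h1, ← Measure.map_apply hP (hG.inter hS), ← hν, ← hνp, withDensity_apply _ (hG.inter hS)]
    calc _ ≤ ∫⁻ _ in {t | p t ≤ ENNReal.ofReal l} ∩ Icc (t - r) (t + r), ENNReal.ofReal l :=
          setLIntegral_mono measurable_const fun x hx => hx.1
      _ ≤ ENNReal.ofReal l * volume (Icc (t - r) (t + r)) := by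
          rw [setLIntegral_const]
          gcongr
          exact inter_subset_right
      _ = ENNReal.ofReal (2 * r * l) := by
          rw [Real.volume_Icc, ← ENNReal.ofReal_mul hl.le]
          congr 1
          ring

/-- The energy of a measure along pairs of cells in a vertical cone is controlled by the square
integrals of its projections in nearby directions. -/
lemma cone_energy_le {μ : Measure ℂ} [IsFiniteMeasure μ] {s : Finset ℂ} {V : ℂ → Set ℂ}
    {ε η θ Q : ℝ} (hη : 0 < η) (hη1 : η ≤ 1) (hε : 0 < ε) (hQ0 : 0 ≤ Q)
    (hVm : ∀ a, MeasurableSet (V a)) (hVs : ∀ a, V a ⊆ closedBall a ε)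
    (hVd : (s : Set ℂ).PairwiseDisjoint V)
    (hS : ∀ a ∈ s, ∀ c ∈ s, a ≠ c → ε ≤ ‖a - c‖)
    (hQ : ∫⁻ φ in Icc (θ - η) (θ + η), projL2sq φ μ ≤ ENNReal.ofReal Q) :
    ∑ a ∈ s, ∑ b ∈ s, (if (a - b) * Complex.exp (-(θ : ℂ) * Complex.I) ∈ vertCone (η / 2) then
      μ.real (V a) * μ.real (V b) / ‖a - b‖ else 0) ≤ 12 * Q / η := by
  set T := (s ×ˢ s).filter fun z : ℂ × ℂ => z.1 ≠ z.2 ∧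
    (z.1 - z.2) * Complex.exp (-(θ : ℂ) * Complex.I) ∈ vertCone (η / 2) with hT
  have hTs : ∀ z ∈ T, z.1 ∈ s ∧ z.2 ∈ s ∧ z.1 ≠ z.2 ∧
      (z.1 - z.2) * Complex.exp (-(θ : ℂ) * Complex.I) ∈ vertCone (η / 2) := fun z hz => by
    rw [hT, Finset.mem_filter, Finset.mem_product] at hz
    exact ⟨hz.1.1, hz.1.2, hz.2⟩
  have hsum : ∑ a ∈ s, ∑ b ∈ s,
      (if (a - b) * Complex.exp (-(θ : ℂ) * Complex.I) ∈ vertCone (η / 2) then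
        μ.real (V a) * μ.real (V b) / ‖a - b‖ else 0) =
      ∑ z ∈ T, μ.real (V z.1) * μ.real (V z.2) / ‖z.1 - z.2‖ := by
    rw [← Finset.sum_product', hT, Finset.sum_filter]
    refine Finset.sum_congr rfl fun z _ => ?_
    by_cases h : z.1 = z.2
    · simp [h]
    · simp [h]
  clear_value T
  rw [hsum]
  have hdir : ∀ z ∈ T, ∃ S ⊆ Icc (θ - η) (θ + η), MeasurableSet S ∧
      ENNReal.ofReal (η * ε / ‖z.1 - z.2‖) ≤ volume S ∧
      ∀ φ ∈ S, |projCoord φ (z.1 - z.2)| ≤ ε := fun z hz => by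
    obtain ⟨h1, h2, h3, h4⟩ := hTs z hz
    exact exists_directions_of_mem_vertCone hη hη1 hε (hS _ h1 _ h2 h3) h4
  choose! S hSJ hSm hSv hSP using hdir
  have hpt : ∀ φ, ∑ z ∈ T, (S z).indicator (fun _ => μ (V z.1) * μ (V z.2)) φ ≤
      ENNReal.ofReal (12 * ε) * projL2sq φ μ := by
    intro φ
    have h1 := prod_strip_le μ φ (δ := 3 * ε) (by positivity)
    rw [show 4 * (3 * ε) = 12 * ε by ring] at h1
    refine le_trans ?_ h1
    have h2 : ∑ z ∈ T, (S z).indicator (fun _ => μ (V z.1) * μ (V z.2)) φ =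
        (μ.prod μ) (⋃ z ∈ T.filter (fun z => φ ∈ S z), V z.1 ×ˢ V z.2) := by
      rw [measure_biUnion_finset]
      · rw [Finset.sum_filter]
        refine Finset.sum_congr rfl fun z _ => ?_
        rw [indicator_apply, Measure.prod_prod]
      · intro z hz w hw hzw
        have hz' := hTs z (Finset.mem_filter.1 hz).1
        have hw' := hTs w (Finset.mem_filter.1 hw).1
        rw [Function.onFun, Set.disjoint_prod]
        by_cases h : z.1 = w.1
        · exact Or.inr (hVd hz'.2.1 hw'.2.1 fun h' => hzw (Prod.ext h h'))
        · exact Or.inl (hVd hz'.1 hw'.1 h)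
      · exact fun z _ => (hVm _).prod (hVm _)
    rw [h2]
    refine measure_mono (iUnion₂_subset fun z hz => ?_)
    rintro ⟨x, y⟩ ⟨hx, hy⟩
    have h3 := hSP z (Finset.mem_filter.1 hz).1 φ (Finset.mem_filter.1 hz).2
    have h4 := (abs_projCoord_le φ (x - z.1)).trans
      (by simpa [dist_eq_norm] using mem_closedBall.1 (hVs _ hx))
    have h5 := (abs_projCoord_le φ (y - z.2)).trans
      (by simpa [dist_eq_norm] using mem_closedBall.1 (hVs _ hy))
    rw [projCoord_sub, abs_le] at h3 h4 h5
    change |projCoord φ x - projCoord φ y| ≤ 3 * ε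
    rw [abs_le]
    constructor <;> linarith [h3.1, h3.2, h4.1, h4.2, h5.1, h5.2]
  have hmain : ENNReal.ofReal (∑ z ∈ T, η * ε / ‖z.1 - z.2‖ * (μ.real (V z.1) * μ.real (V z.2))) ≤
      ENNReal.ofReal (12 * ε * Q) := by
    calc ENNReal.ofReal (∑ z ∈ T, η * ε / ‖z.1 - z.2‖ * (μ.real (V z.1) * μ.real (V z.2)))
        = ∑ z ∈ T, ENNReal.ofReal (η * ε / ‖z.1 - z.2‖) * (μ (V z.1) * μ (V z.2)) := by
          rw [ENNReal.ofReal_sum_of_nonneg fun z _ => by positivity]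
          refine Finset.sum_congr rfl fun z _ => ?_
          rw [ENNReal.ofReal_mul (by positivity), ENNReal.ofReal_mul (by positivity),
            ofReal_measureReal, ofReal_measureReal]
      _ ≤ ∑ z ∈ T, ∫⁻ φ in Icc (θ - η) (θ + η),
            (S z).indicator (fun _ => μ (V z.1) * μ (V z.2)) φ := by
          refine Finset.sum_le_sum fun z hz => ?_
          rw [lintegral_indicator (hSm z hz), setLIntegral_const,
            Measure.restrict_apply (hSm z hz), inter_eq_self_of_subset_left (hSJ z hz), mul_comm]
          gcongr
          exact hSv z hz
      _ = ∫⁻ φ in Icc (θ - η) (θ + η),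
            ∑ z ∈ T, (S z).indicator (fun _ => μ (V z.1) * μ (V z.2)) φ :=
          (lintegral_finsetSum' _ fun z hz =>
            (measurable_const.indicator (hSm z hz)).aemeasurable).symm
      _ ≤ ∫⁻ φ in Icc (θ - η) (θ + η), ENNReal.ofReal (12 * ε) * projL2sq φ μ :=
          lintegral_mono hpt
      _ = ENNReal.ofReal (12 * ε) * ∫⁻ φ in Icc (θ - η) (θ + η), projL2sq φ μ :=
          lintegral_const_mul' _ _ ENNReal.ofReal_ne_top
      _ ≤ ENNReal.ofReal (12 * ε * Q) := by
          rw [ENNReal.ofReal_mul (by positivity : 0 ≤ 12 * ε)]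
          gcongr
  rw [ENNReal.ofReal_le_ofReal_iff (by positivity)] at hmain
  have hfac : ∑ z ∈ T, η * ε / ‖z.1 - z.2‖ * (μ.real (V z.1) * μ.real (V z.2)) =
      ε * (η * ∑ z ∈ T, μ.real (V z.1) * μ.real (V z.2) / ‖z.1 - z.2‖) := by
    rw [Finset.mul_sum, Finset.mul_sum]
    refine Finset.sum_congr rfl fun z _ => ?_
    ring
  rw [hfac, show 12 * ε * Q = ε * (12 * Q) by ring] at hmain
  rw [le_div_iff₀ hη, mul_comm]
  exact le_of_mul_le_mul_left hmain hε

/-- Some direction in an interval has a projection whose square integral is at most average. -/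
lemma exists_projL2sq_le {μ : Measure ℂ} {η θ Q : ℝ} (hη : 0 < η) (hQ0 : 0 < Q)
    (hQ : ∫⁻ φ in Icc (θ - η) (θ + η), projL2sq φ μ ≤ ENNReal.ofReal Q) :
    ∃ φ, projL2sq φ μ ≤ ENNReal.ofReal (Q / η) := by
  by_contra! h
  have h1 : ∫⁻ _ in Icc (θ - η) (θ + η), ENNReal.ofReal (Q / η) ≤ ENNReal.ofReal Q :=
    (lintegral_mono fun φ => (h φ).le).trans hQ
  rw [setLIntegral_const, Real.volume_Icc, ← ENNReal.ofReal_mul (by positivity),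
    ENNReal.ofReal_le_ofReal_iff hQ0.le] at h1
  have h2 : Q / η * (θ + η - (θ - η)) = 2 * Q := by
    field_simp
    ring
  linarith

/-- The lower bound for the analytic capacity in terms of the projections onto an interval of
directions centred at `θ`. -/
lemma le_analyticCapacity_of_lintegral_projL2sq_le {E : Set ℂ} (hE : IsCompact E) {μ : Measure ℂ}
    [IsFiniteMeasure μ] {η θ Q : ℝ} (hη : 0 < η) (hη1 : η ≤ 1) (hQ0 : 0 < Q)
    (hQ : ∫⁻ φ in Icc (θ - η) (θ + η), projL2sq φ μ ≤ ENNReal.ofReal Q) (hm0 : 0 < μ.real E) :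
    η / 16 / (646 + 10380 / (η / 2) ^ 8 * 31) * μ.real E ^ 2 / Q ≤ analyticCapacity E := by
  set m := μ.real E with hm
  obtain ⟨φ, hφ⟩ := exists_projL2sq_le hη hQ0 hQ
  set l := 2 * Q / (η * m) with hl
  have hl0 : 0 < l := by positivity
  obtain ⟨G, hGm, hGc, hG⟩ := exists_strip_growth hl0 hφ
  have hql : Q / η / l = m / 2 := by
    rw [hl]
    field_simp
  rw [hql] at hGc
  have hGc' : μ.real Gᶜ ≤ m / 2 := ENNReal.toReal_le_of_le_ofReal (by positivity) hGc
  refine le_analyticCapacity_of_forall_nhds hE fun δ hδ => ?_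
  obtain ⟨s, hsE, hsep, hcov⟩ := exists_separated_net hE (ε := 2 * δ) (by positivity)
  obtain ⟨V, hVm, hVs, hVd, hVc⟩ := exists_disjoint_cells s (2 * δ)
  set A := 4 * l with hA
  have hA0 : 0 < A := by positivity
  have hVGd : (s : Set ℂ).PairwiseDisjoint fun a => G ∩ V a := fun a ha c hc hac =>
    (hVd ha hc hac).mono inter_subset_right inter_subset_right
  have hVGm : ∀ a, MeasurableSet (G ∩ V a) := fun a => hGm.inter (hVm a)
  have hmass : m / 2 ≤ ∑ a ∈ s, μ.real (G ∩ V a) := by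
    rw [← measureReal_biUnion_finset hVGd fun a _ => hVGm a]
    have h1 : E ⊆ (⋃ a ∈ s, G ∩ V a) ∪ Gᶜ := fun x hx => by
      by_cases hxG : x ∈ G
      · obtain ⟨a, ha, hxa⟩ := mem_iUnion₂.1 (hVc (hcov hx))
        exact Or.inl (mem_iUnion₂.2 ⟨a, ha, hxG, hxa⟩)
      · exact Or.inr hxG
    have h2 := (measureReal_mono (μ := μ) h1).trans (measureReal_union_le _ _)
    linarith
  have hgrow : ∀ a ∈ s, ∀ r, 2 * δ ≤ r →
      ∑ c ∈ s with ‖a - c‖ ≤ r, μ.real (G ∩ V c) / A ≤ r := by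
    intro a _ r hr
    have hr0 : 0 ≤ r := by linarith
    rw [← Finset.sum_div, div_le_iff₀ hA0, ← measureReal_biUnion_finset
      (hVGd.subset fun c hc => (Finset.mem_filter.1 hc).1) fun c _ => hVGm c]
    refine ENNReal.toReal_le_of_le_ofReal (by positivity) ?_
    have h1 := hG (projCoord φ a) (2 * r)
    rw [show 2 * (2 * r) * l = r * A by rw [hA]; ring] at h1
    refine le_trans (measure_mono (iUnion₂_subset fun c hc => ?_)) h1
    rintro x ⟨hxG, hxV⟩
    refine ⟨hxG, ?_⟩
    rw [mem_ofPred_eq, ← projCoord_sub]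
    refine (abs_projCoord_le _ _).trans ?_
    have h2 := mem_closedBall.1 (hVs c hxV)
    have h3 := (Finset.mem_filter.1 hc).2
    rw [← dist_eq_norm] at h3 ⊢
    have h4 := dist_triangle x c a
    rw [dist_comm c a] at h4
    linarith
  have henergy : ∑ a ∈ s, ∑ b ∈ s,
      (if (a - b) * Complex.exp (-(θ : ℂ) * Complex.I) ∈ vertCone (η / 2) then
        μ.real (G ∩ V a) / A * (μ.real (G ∩ V b) / A) / ‖a - b‖ else 0) ≤
      3 * ∑ a ∈ s, μ.real (G ∩ V a) / A := by
    have h1 := cone_energy_le (μ := μ) hη hη1 (by positivity : 0 < 2 * δ) hQ0.le hVGm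
      (fun a => inter_subset_right.trans (hVs a)) hVGd hsep hQ
    have h2 : ∑ a ∈ s, ∑ b ∈ s,
        (if (a - b) * Complex.exp (-(θ : ℂ) * Complex.I) ∈ vertCone (η / 2) then
          μ.real (G ∩ V a) / A * (μ.real (G ∩ V b) / A) / ‖a - b‖ else 0) =
        (∑ a ∈ s, ∑ b ∈ s,
          (if (a - b) * Complex.exp (-(θ : ℂ) * Complex.I) ∈ vertCone (η / 2) then
            μ.real (G ∩ V a) * μ.real (G ∩ V b) / ‖a - b‖ else 0)) / A ^ 2 := by
      rw [Finset.sum_div]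
      refine Finset.sum_congr rfl fun a _ => ?_
      rw [Finset.sum_div]
      refine Finset.sum_congr rfl fun b _ => ?_
      split_ifs
      · field_simp
      · simp
    rw [h2, ← Finset.sum_div]
    calc _ ≤ 12 * Q / η / A ^ 2 := by gcongr
      _ = 3 / 2 * m / A := by
        rw [hA, hl]
        field_simp
        ring
      _ ≤ 3 * ((∑ a ∈ s, μ.real (G ∩ V a)) / A) := by
        rw [← mul_div_assoc 3]
        exact div_le_div_of_nonneg_right (by linarith) hA0.le
  obtain ⟨f, hf, hf1, d, hd, hd0⟩ := exists_bounded_holomorphic_of_cone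
    (m := fun a => μ.real (G ∩ V a) / A) (fun a => by positivity) (by positivity : 0 < 2 * δ) hgrow
    hsep (κ := η / 2) (by positivity) (by linarith) (norm_exp_neg_mul_I θ) (by norm_num) henergy
  have hsub : ∀ z : ℂ, (∀ y ∈ E, δ < ‖z - y‖) → ∀ a ∈ s, 2 * δ / 2 < ‖z - a‖ :=
    fun z hz a ha => by
      rw [mul_div_cancel_left₀ _ two_ne_zero]
      exact hz a (hsE ha)
  refine ⟨f, hf.mono hsub, fun z hz => hf1 z (hsub z hz), d, hd, le_trans ?_ hd0⟩
  rw [← Finset.sum_div, show (7 : ℝ) + 8 * 3 = 31 by norm_num]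
  calc η / 16 / (646 + 10380 / (η / 2) ^ 8 * 31) * m ^ 2 / Q
      = m / 2 / A / (646 + 10380 / (η / 2) ^ 8 * 31) := by
        have hD : 0 < 646 + 10380 / (η / 2) ^ 8 * 31 := by positivity
        set D := 646 + 10380 / (η / 2) ^ 8 * 31
        rw [hA, hl]
        field_simp
        norm_num
    _ ≤ _ := by gcongr

/-- An order-connected bounded set of positive length contains a closed interval of half its
length. -/
lemma exists_Icc_subset_of_ordConnected {I : Set ℝ} (hI : I.OrdConnected)
    (hb : Bornology.IsBounded I) (h0 : 0 < volume I) :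
    ∃ θ, Icc (θ - (volume I).toReal / 4) (θ + (volume I).toReal / 4) ⊆ I := by
  have hfin : volume I ≠ ⊤ := hb.measure_lt_top.ne
  have hl : 0 < (volume I).toReal := ENNReal.toReal_pos h0.ne' hfin
  have hne : ∃ a ∈ I, ∃ b ∈ I, (volume I).toReal / 2 ≤ b - a := by
    by_contra! h
    have h1 : ediam I ≤ ENNReal.ofReal ((volume I).toReal / 2) := by
      refine ediam_le fun x hx y hy => ?_
      rw [edist_dist, Real.dist_eq]
      refine ENNReal.ofReal_le_ofReal (abs_le.2 ⟨?_, ?_⟩)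
      · linarith [h x hx y hy]
      · linarith [h y hy x hx]
    have h2 := ENNReal.toReal_le_of_le_ofReal (by positivity) ((Real.volume_le_diam I).trans h1)
    linarith
  obtain ⟨a, ha, b, hb, hab⟩ := hne
  refine ⟨(a + b) / 2, Subset.trans (Icc_subset_Icc ?_ ?_) (hI.out ha hb)⟩ <;> linarith

/-- If `I ⊆ [0,π)` is an interval with `ℋ¹(I) > 0`, there is a constant
`c > 0` depending only on `ℋ¹(I)` such that for every compact `E ⊆ ℂ` and every finite Borel
measure `μ` supported on `E` with `0 < ∫_I ‖P_θ μ‖₂² dθ`, one has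
`γ(E) ≥ c · μ(E)² / ∫_I ‖P_θ μ‖₂² dθ`. -/
theorem statement0 :
    ∃ c : ℝ≥0∞ → ℝ, ∀ I : Set ℝ, I.OrdConnected → I ⊆ Set.Ico 0 π →
      0 < (μH[1] : Measure ℝ) I →
      (0 < c ((μH[1] : Measure ℝ) I)) ∧
      ∀ E : Set ℂ, IsCompact E → ∀ μ : Measure ℂ, IsFiniteMeasure μ → μ Eᶜ = 0 →
        0 < ∫⁻ θ in I, projL2sq θ μ →
        ENNReal.ofReal (c ((μH[1] : Measure ℝ) I)) * (μ E) ^ 2 / (∫⁻ θ in I, projL2sq θ μ)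
          ≤ ENNReal.ofReal (analyticCapacity E) := by
  refine ⟨fun t => t.toReal / 4 / 16 / (646 + 10380 / (t.toReal / 4 / 2) ^ 8 * 31),
    fun I hI hIπ h0 => ?_⟩
  rw [hausdorffMeasure_real] at h0 ⊢
  have hfin : volume I ≠ ⊤ := ((isBounded_Ico 0 π).subset hIπ).measure_lt_top.ne
  have hl : 0 < (volume I).toReal := ENNReal.toReal_pos h0.ne' hfin
  refine ⟨by positivity, fun E hE μ hμ _ hpos => ?_⟩
  obtain ⟨θ, hθ⟩ := exists_Icc_subset_of_ordConnected hI ((isBounded_Ico 0 π).subset hIπ) h0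
  have hle : (volume I).toReal / 4 ≤ 1 := by
    have h1 : volume I ≤ ENNReal.ofReal π := by
      simpa using measure_mono (μ := volume) hIπ
    have h2 := ENNReal.toReal_le_of_le_ofReal Real.pi_pos.le h1
    linarith [Real.pi_le_four]
  set η := (volume I).toReal / 4 with hη
  have hη0 : 0 < η := by positivity
  by_cases hQ : ∫⁻ θ in I, projL2sq θ μ = ⊤
  · simp [hQ]
  by_cases hm : μ E = 0
  · simp [hm]
  have hmr : 0 < μ.real E := ENNReal.toReal_pos hm (measure_ne_top μ E)
  have hQr : 0 < (∫⁻ θ in I, projL2sq θ μ).toReal := ENNReal.toReal_pos hpos.ne' hQ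
  have key := le_analyticCapacity_of_lintegral_projL2sq_le hE (μ := μ) hη0 hle hQr
    (by rw [ENNReal.ofReal_toReal hQ]; exact lintegral_mono_set hθ) hmr
  refine le_trans (le_of_eq ?_) (ENNReal.ofReal_le_ofReal key)
  rw [ENNReal.ofReal_div_of_pos hQr, ENNReal.ofReal_toReal hQ, ENNReal.ofReal_mul (by positivity),
    ENNReal.ofReal_pow hmr.le, ofReal_measureReal]
end

section
/- There exists a Borel set E ⊂ ℝ² with the following two properties: (1) ℋ¹(P_θ(E)) > 0 for almost every θ ∈ [0,π); (2) for every Borel measure μ on ℝ² with μ(E) > 0 and every nondegenerate interval I ⊂ [0,π), the set of θ ∈ I for which P_θμ fails to be absolutely continuous with square-integrable density has positive Lebesgue measure. -/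
open MeasureTheory Measure Set Filter Metric
open scoped ENNReal Real Topology Classical

/-- The set of convergent sums `∑ aₖ uₖ` with digits `aₖ ∈ {0, …, Nₖ - 1}`. -/
def digitSums {E : Type*} [NormedAddCommGroup E] [NormedSpace ℝ E] (N : ℕ → ℕ) (u : ℕ → E) :
    Set E :=
  {z | ∃ a : ℕ → ℕ, (∀ k, a k < N k) ∧ HasSum (fun k => (a k : ℝ) • u k) z}

section DigitSums

variable {E : Type*} [NormedAddCommGroup E] [NormedSpace ℝ E]

lemma norm_digit_smul_le {N : ℕ → ℕ} {a : ℕ → ℕ} (u : ℕ → E) {k : ℕ} (ha : a k < N k) :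
    ‖(a k : ℝ) • u k‖ ≤ N k * ‖u k‖ := by
  rw [norm_smul, Real.norm_natCast]
  gcongr

variable [CompleteSpace E]

lemma summable_digit_smul {N : ℕ → ℕ} {u : ℕ → E} (hu : Summable fun k => N k * ‖u k‖)
    {a : ℕ → ℕ} (ha : ∀ k, a k < N k) : Summable fun k => (a k : ℝ) • u k :=
  Summable.of_norm_bounded hu fun k => norm_digit_smul_le u (ha k)

lemma isCompact_digitSums {N : ℕ → ℕ} {u : ℕ → E} (hu : Summable fun k => N k * ‖u k‖) :
    IsCompact (digitSums N u) := by
  have hcont : Continuous fun a : (∀ k, Fin (N k)) => ∑' k, ((a k : ℕ) : ℝ) • u k := by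
    refine continuous_tsum (fun k => ?_) hu fun k a => ?_
    · have h1 : Continuous fun i : Fin (N k) => ((i : ℕ) : ℝ) := continuous_of_discreteTopology
      exact (h1.comp (continuous_apply k)).smul continuous_const
    · exact norm_digit_smul_le (a := fun j => (a j : ℕ)) u (a k).2
  convert isCompact_range hcont
  ext z
  constructor
  · rintro ⟨a, ha, hz⟩
    exact ⟨fun k => ⟨a k, ha k⟩, hz.tsum_eq⟩
  · rintro ⟨a, rfl⟩
    exact ⟨fun k => a k, fun k => (a k).2, (summable_digit_smul hu fun k => (a k).2).hasSum⟩

lemma image_digitSums {F : Type*} [NormedAddCommGroup F] [NormedSpace ℝ F]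
    (f : E →L[ℝ] F) {N : ℕ → ℕ} {u : ℕ → E} (hu : Summable fun k => N k * ‖u k‖) :
    f '' digitSums N u = digitSums N fun k => f (u k) := by
  ext z
  constructor
  · rintro ⟨w, ⟨a, ha, hw⟩, rfl⟩
    exact ⟨a, ha, by simpa using f.hasSum hw⟩
  · rintro ⟨a, ha, hz⟩
    have h := (summable_digit_smul hu ha).hasSum
    exact ⟨_, ⟨a, ha, h⟩, (f.hasSum h).unique (by simpa using hz)⟩

end DigitSums

lemma digitSums_subset_iUnion (N : ℕ → ℕ) (u : ℕ → ℝ) :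
    digitSums N u ⊆ ⋃ i ∈ Finset.range (N 0),
      (fun t => (i : ℝ) * u 0 + t) '' digitSums (fun k => N (k + 1)) (fun k => u (k + 1)) := by
  rintro z ⟨a, ha, hz⟩
  simp only [mem_iUnion, Finset.mem_range]
  refine ⟨a 0, ha 0, z - a 0 * u 0, ⟨fun k => a (k + 1), fun k => ha _, ?_⟩, by simp⟩
  have := (hasSum_nat_add_iff' (f := fun k => (a k : ℝ) • u k) 1).2 hz
  simpa using this

lemma volume_digitSums_le_mul (N : ℕ → ℕ) (u : ℕ → ℝ) :
    volume (digitSums N u) ≤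
      N 0 * volume (digitSums (fun k => N (k + 1)) (fun k => u (k + 1))) := by
  refine (measure_mono (digitSums_subset_iUnion N u)).trans ?_
  refine (measure_biUnion_finset_le _ _).trans ?_
  simp

lemma volume_digitSums_le_prod_mul (k : ℕ) (N : ℕ → ℕ) (u : ℕ → ℝ) :
    volume (digitSums N u) ≤ (∏ j ∈ Finset.range k, N j : ℕ) *
      volume (digitSums (fun j => N (j + k)) (fun j => u (j + k))) := by
  induction k with
  | zero => simp
  | succ k ih =>
    refine ih.trans ?_
    rw [Finset.prod_range_succ, Nat.cast_mul, mul_assoc]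
    gcongr
    refine (volume_digitSums_le_mul _ _).trans ?_
    simp [add_assoc, add_comm 1 k]

lemma volume_digitSums_le_of_hasSum {N : ℕ → ℕ} {u : ℕ → ℝ} {s : ℝ}
    (hu : HasSum (fun k => N k * |u k|) s) : volume (digitSums N u) ≤ ENNReal.ofReal (2 * s) := by
  have : digitSums N u ⊆ Icc (-s) s := by
    rintro z ⟨a, ha, hz⟩
    rw [mem_Icc, ← abs_le, ← hz.tsum_eq, ← hu.tsum_eq, ← Real.norm_eq_abs]
    exact tsum_of_norm_bounded hu.summable.hasSum fun k => norm_digit_smul_le u (ha k)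
  refine (measure_mono this).trans ?_
  rw [Real.volume_Icc]
  exact ENNReal.ofReal_le_ofReal (by linarith)

lemma exists_digit {N : ℕ} (hN : 0 < N) (u t : ℝ) (ht : |t| ≤ N * |u| / 2) :
    ∃ a : ℕ, a < N ∧ |t - (a - ((N : ℝ) - 1) / 2) * u| ≤ |u| / 2 := by
  rcases eq_or_ne u 0 with rfl | hu
  · exact ⟨0, hN, by simpa using ht⟩
  have key : ∃ a : ℕ, a < N ∧ (a : ℝ) ≤ t / u + N / 2 ∧ t / u + N / 2 ≤ a + 1 := by
    have hs : |t / u| ≤ N / 2 := by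
      rw [abs_div, div_le_iff₀ (abs_pos.2 hu)]
      linarith
    obtain ⟨h1, h2⟩ := abs_le.1 hs
    set y := t / u + N / 2 with hy
    have hy0 : 0 ≤ y := by linarith
    have hyN : y ≤ N := by linarith
    rcases hyN.lt_or_eq with h | h
    · exact ⟨⌊y⌋₊, (Nat.floor_lt hy0).2 h, Nat.floor_le hy0, (Nat.lt_floor_add_one y).le⟩
    · refine ⟨N - 1, by omega, ?_, ?_⟩ <;> rw [Nat.cast_pred hN, h] <;> linarith
  obtain ⟨a, haN, h1, h2⟩ := key
  refine ⟨a, haN, ?_⟩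
  have : t - (a - ((N : ℝ) - 1) / 2) * u = (t / u + N / 2 - a - 1 / 2) * u := by
    field_simp
    ring
  rw [this, abs_mul]
  have : |t / u + N / 2 - a - 1 / 2| ≤ 1 / 2 := abs_le.2 ⟨by linarith, by linarith⟩
  nlinarith [abs_nonneg u]

lemma volume_digitSums_pos {N : ℕ → ℕ} {u : ℕ → ℝ} (hN : ∀ k, 0 < N k) (hu0 : u 0 ≠ 0)
    (hu : Summable fun k => N k * |u k|) (h : ∀ k, |u k| ≤ N (k + 1) * |u (k + 1)|) :
    volume (digitSums N u) ≠ 0 := by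
  choose! a haN ha using fun k t (ht : |t| ≤ N k * |u k| / 2) => exists_digit (hN k) (u k) t ht
  have hsum : Summable fun k => ((N k : ℝ) - 1) / 2 * u k := by
    refine Summable.of_norm_bounded hu fun k => ?_
    have h1 : (1 : ℝ) ≤ N k := by exact_mod_cast hN k
    rw [norm_mul, Real.norm_eq_abs, Real.norm_eq_abs]
    gcongr
    rw [abs_of_nonneg (by linarith)]
    linarith
  set c := ∑' k, ((N k : ℝ) - 1) / 2 * u k
  set δ := N 0 * |u 0| / 2 with hδ
  have hδ0 : 0 < δ := by
    have := hN 0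
    have := abs_pos.2 hu0
    positivity
  have hsub : Icc (c - δ) (c + δ) ⊆ digitSums N u := by
    intro z hz
    obtain ⟨r, hr0, hrs⟩ : ∃ r : ℕ → ℝ, r 0 = z - c ∧
        ∀ k, r (k + 1) = r k - (a k (r k) - ((N k : ℝ) - 1) / 2) * u k :=
      ⟨fun k => Nat.rec (z - c) (fun k t => t - (a k t - ((N k : ℝ) - 1) / 2) * u k) k,
        rfl, fun k => rfl⟩
    have hr : ∀ k, |r k| ≤ N k * |u k| / 2 := by
      intro k
      induction k with
      | zero =>
        rw [hr0, ← hδ, abs_le]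
        obtain ⟨h1, h2⟩ := hz
        constructor <;> linarith
      | succ k ih =>
        rw [hrs]
        refine (ha k _ ih).trans ?_
        have := h k
        linarith
    refine ⟨fun k => a k (r k), fun k => haN k _ (hr k), ?_⟩
    have hs : Summable fun k => (a k (r k) : ℝ) • u k :=
      summable_digit_smul (u := u) (a := fun k => a k (r k)) hu fun k => haN k _ (hr k)
    have hlim : Tendsto r atTop (𝓝 0) := by
      refine squeeze_zero_norm hr ?_
      simpa using hu.tendsto_atTop_zero.div_const 2
    have hpart : ∀ n, ∑ k ∈ Finset.range n, (a k (r k) : ℝ) • u k =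
        z - c - r n + ∑ k ∈ Finset.range n, ((N k : ℝ) - 1) / 2 * u k := by
      intro n
      induction n with
      | zero => simp [hr0]
      | succ n ih =>
        rw [Finset.sum_range_succ, ih, Finset.sum_range_succ, hrs, smul_eq_mul]
        ring
    have hz' : Tendsto (fun n => ∑ k ∈ Finset.range n, (a k (r k) : ℝ) • u k) atTop (𝓝 z) := by
      simp_rw [hpart]
      have := (hlim.const_sub (z - c)).add hsum.hasSum.tendsto_sum_nat
      rwa [sub_zero, sub_add_cancel] at this
    have := tendsto_nhds_unique hz' hs.hasSum.tendsto_sum_nat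
    rw [this]
    exact hs.hasSum
  refine (lt_of_lt_of_le ?_ (measure_mono hsub)).ne'
  rw [Real.volume_Icc, ENNReal.ofReal_pos]
  linarith

/-- `projCoord θ` as a continuous real-linear map. -/
noncomputable def projCoordCLM (θ : ℝ) : ℂ →L[ℝ] ℝ :=
  Real.cos θ • Complex.reCLM + Real.sin θ • Complex.imCLM

lemma coe_projCoordCLM (θ : ℝ) : ⇑(projCoordCLM θ) = projCoord θ := by
  ext z
  rw [projCoord, ← Complex.ofReal_neg, Complex.exp_mul_I]
  simp [projCoordCLM, Complex.mul_re, ← Complex.ofReal_cos, ← Complex.ofReal_sin]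
  ring

lemma projCoordCLM_I_mul_exp (θ x : ℝ) :
    projCoordCLM θ (Complex.I * Complex.exp (x * Complex.I)) = Real.sin (θ - x) := by
  rw [Complex.exp_mul_I, Real.sin_sub]
  simp [projCoordCLM, ← Complex.ofReal_cos, ← Complex.ofReal_sin]
  ring

lemma hausdorffMeasure_image_projPt (θ : ℝ) (E : Set ℂ) :
    (μH[1] : Measure ℂ) (projPt θ '' E) = volume (projCoord θ '' E) := by
  have hiso : Isometry fun r : ℝ => (r : ℂ) * Complex.exp ((θ : ℂ) * Complex.I) := by
    refine Isometry.of_dist_eq fun r s => ?_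
    rw [dist_eq_norm, ← sub_mul, norm_mul, Complex.norm_exp_ofReal_mul_I, mul_one,
      ← Complex.ofReal_sub, Complex.norm_real, dist_eq_norm]
  have : projPt θ '' E =
      (fun r : ℝ => (r : ℂ) * Complex.exp ((θ : ℂ) * Complex.I)) '' (projCoord θ '' E) := by
    rw [image_image]
    rfl
  rw [this, hiso.hausdorffMeasure_image (Or.inl zero_le_one), hausdorffMeasure_real]

lemma projL2sq_eq_top {θ : ℝ} {μ : Measure ℂ} {E : Set ℂ} (hE : μ E ≠ 0)
    (h : volume (projCoord θ '' E) = 0) : projL2sq θ μ = ⊤ := by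
  rw [projL2sq, dif_neg]
  intro hac
  have hm : AEMeasurable (projCoord θ) μ := by
    rw [← coe_projCoordCLM]
    exact (projCoordCLM θ).continuous.aemeasurable
  exact hE (le_antisymm ((le_map_apply_image hm E).trans (hac h).le) zero_le)

/-- A set built from tilted directions `x k` whose projection is null in directions `θ` that are
approached by `x k` fast compared to `R k`, and has positive length in directions `θ` for which
`R k * |sin (θ - x k)|` is positive and nondecreasing. -/
lemma exists_set_of_directions (x R : ℕ → ℝ) (hR : ∀ k, 1 ≤ R k) :
    ∃ E : Set ℂ, MeasurableSet E ∧
      (∀ θ, (∀ ε > 0, ∃ᶠ k in atTop, R k * |Real.sin (θ - x k)| ≤ ε) →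
        volume (projCoord θ '' E) = 0) ∧
      ∀ θ, Real.sin (θ - x 0) ≠ 0 →
        (∀ k, R k * |Real.sin (θ - x k)| ≤ R (k + 1) * |Real.sin (θ - x (k + 1))|) →
        volume (projCoord θ '' E) ≠ 0 := by
  obtain ⟨N, hN⟩ : ∃ N : ℕ → ℕ, ∀ k, 2 ^ (k + 1) * R (k + 1) ≤ N k :=
    ⟨fun k => ⌈2 ^ (k + 1) * R (k + 1)⌉₊, fun k => Nat.le_ceil _⟩
  have hR0 : ∀ k, 0 < R k := fun k => zero_lt_one.trans_le (hR k)
  have hN0 : ∀ k, 0 < N k := fun k => by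
    have : (0 : ℝ) < N k := lt_of_lt_of_le (mul_pos (by positivity) (hR0 _)) (hN k)
    exact_mod_cast this
  have hN0' : ∀ k, (0 : ℝ) < N k := fun k => Nat.cast_pos.2 (hN0 k)
  set P : ℕ → ℝ := fun k => ∏ j ∈ Finset.range k, (N j : ℝ) with hP
  have hP0 : ∀ k, 0 < P k := fun k => Finset.prod_pos fun j _ => hN0' j
  have hPs : ∀ k, P (k + 1) = P k * N k := fun k => Finset.prod_range_succ _ _
  have hPmono : Monotone P := monotone_nat_of_le_succ fun k => by
    rw [hPs]
    exact le_mul_of_one_le_right (hP0 k).le (by exact_mod_cast hN0 k)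
  set d : ℕ → ℝ := fun k => R k / P (k + 1) with hd
  have hd0 : ∀ k, 0 < d k := fun k => div_pos (hR0 k) (hP0 _)
  have hNd : ∀ k, N k * d k = R k / P k := fun k => by
    rw [hd]
    have := (hN0' k).ne'
    have := (hP0 k).ne'
    simp only [hPs]
    field_simp
  have htail : ∀ k j,
      P k * (N (j + (k + 1)) * d (j + (k + 1))) ≤ (1 / 2) ^ k * (1 / 2) ^ (j + 1) := by
    intro k j
    have h1 := hN (j + k)
    have h2 : P k ≤ P (j + k) := hPmono (by omega)
    rw [hNd, ← add_assoc, hPs, ← mul_div_assoc, div_le_iff₀ (mul_pos (hP0 _) (hN0' _))]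
    calc P k * R (j + k + 1)
        = (1 / 2) ^ k * (1 / 2) ^ (j + 1) * (P k * (2 ^ (j + k + 1) * R (j + k + 1))) := by
          have : (1 / 2 : ℝ) ^ k * (1 / 2) ^ (j + 1) * 2 ^ (j + k + 1) = 1 := by
            rw [← pow_add, show k + (j + 1) = j + k + 1 by ring, ← mul_pow]
            norm_num
          linear_combination (- P k * R (j + k + 1)) * this
      _ ≤ (1 / 2) ^ k * (1 / 2) ^ (j + 1) * (P (j + k) * N (j + k)) := by
          have := hR0 (j + k + 1)
          have := (hP0 k).le
          gcongr
  have hgeo : HasSum (fun j : ℕ => (1 / 2 : ℝ) ^ (j + 1)) 1 := by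
    simpa [pow_succ] using hasSum_geometric_two.mul_right (1 / 2 : ℝ)
  have hsum : Summable fun k => N k * d k := by
    refine (summable_nat_add_iff 1).1 ?_
    refine Summable.of_nonneg_of_le (fun j => (mul_pos (hN0' _) (hd0 _)).le) (fun j => ?_)
      hgeo.summable
    simpa [hP] using htail 0 j
  set u : ℕ → ℂ := fun k => (d k : ℝ) • (Complex.I * Complex.exp (x k * Complex.I)) with hu
  have hun : ∀ k, ‖u k‖ = d k := fun k => by
    rw [hu, norm_smul, norm_mul, Complex.norm_exp_ofReal_mul_I, Complex.norm_I,
      Real.norm_of_nonneg (hd0 k).le]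
    ring
  have husum : Summable fun k => N k * ‖u k‖ := by simpa only [hun] using hsum
  have himage : ∀ θ, projCoord θ '' digitSums N u =
      digitSums N fun k => d k * Real.sin (θ - x k) := fun θ => by
    rw [← coe_projCoordCLM, image_digitSums _ husum]
    simp only [hu, map_smul, projCoordCLM_I_mul_exp, smul_eq_mul]
  have hle : ∀ θ k, N k * |d k * Real.sin (θ - x k)| ≤ N k * d k := fun θ k => by
    rw [abs_mul, abs_of_pos (hd0 k)]
    have := Real.abs_sin_le_one (θ - x k)
    have := hd0 k
    gcongr
    nlinarith
  have hθsum : ∀ θ, Summable fun k => N k * |d k * Real.sin (θ - x k)| := fun θ =>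
    Summable.of_nonneg_of_le (fun k => by positivity) (hle θ) hsum
  refine ⟨digitSums N u, (isCompact_digitSums husum).measurableSet, fun θ hθ => ?_,
    fun θ hθ0 hθ => ?_⟩
  · rw [himage]
    have hvol : ∀ k, volume (digitSums N fun k => d k * Real.sin (θ - x k)) ≤
        ENNReal.ofReal (2 * (R k * |Real.sin (θ - x k)| + (1 / 2) ^ k)) := by
      intro k
      have hs := (summable_nat_add_iff k).2 (hθsum θ)
      refine (volume_digitSums_le_prod_mul k _ _).trans ?_
      refine (mul_le_mul_right (volume_digitSums_le_of_hasSum hs.hasSum) _).trans ?_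
      have : ((∏ j ∈ Finset.range k, N j : ℕ) : ℝ≥0∞) = ENNReal.ofReal (P k) := by
        rw [← ENNReal.ofReal_natCast, hP, Nat.cast_prod]
      rw [this, ← ENNReal.ofReal_mul (hP0 k).le]
      refine ENNReal.ofReal_le_ofReal ?_
      rw [hs.tsum_eq_zero_add]
      have h0 : P k * (N (0 + k) * |d (0 + k) * Real.sin (θ - x (0 + k))|) =
          R k * |Real.sin (θ - x k)| := by
        rw [zero_add, abs_mul, abs_of_pos (hd0 k), ← mul_assoc (N k : ℝ), hNd]
        have := (hP0 k).ne'
        field_simp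
      have h1 : P k * ∑' j, N (j + 1 + k) * |d (j + 1 + k) * Real.sin (θ - x (j + 1 + k))| ≤
          (1 / 2) ^ k := by
        rw [← tsum_mul_left]
        refine (Summable.tsum_le_tsum (fun j => ?_)
          (((summable_nat_add_iff 1).2 hs).mul_left _) (hgeo.mul_left _).summable).trans
          (by rw [(hgeo.mul_left ((1 / 2 : ℝ) ^ k)).tsum_eq, mul_one])
        refine (mul_le_mul_of_nonneg_left (hle θ _) (hP0 k).le).trans ?_
        simpa [add_assoc, add_comm 1 k] using htail k j
      linarith
    refine le_antisymm (ENNReal.le_of_forall_pos_le_add fun ε hε _ => ?_) zero_le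
    have hε' : (0 : ℝ) < ε / 4 := by positivity
    have hev : ∀ᶠ k : ℕ in atTop, (1 / 2 : ℝ) ^ k ≤ ε / 4 :=
      (tendsto_pow_atTop_nhds_zero_of_lt_one (by norm_num) (by norm_num)).eventually_le_const hε'
    obtain ⟨k, hk1, hk2⟩ := ((hθ _ hε').and_eventually hev).exists
    refine (hvol k).trans ?_
    rw [zero_add, ← ENNReal.ofReal_coe_nnreal]
    exact ENNReal.ofReal_le_ofReal (by linarith)
  · rw [himage]
    refine volume_digitSums_pos hN0 (mul_ne_zero (hd0 0).ne' hθ0) (hθsum θ) fun k => ?_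
    rw [abs_mul, abs_mul, abs_of_pos (hd0 k), abs_of_pos (hd0 _), ← mul_assoc, hNd, hd,
      div_mul_eq_mul_div, div_mul_eq_mul_div]
    exact div_le_div_of_nonneg_right (hθ k) (hP0 _).le

/-- A path sweeping through the intervals `[q n, q n + ℓ n]` one after another, in small steps. -/
lemma exists_sweep (q ℓ : ℕ → ℝ) (hℓ0 : ∀ n, 0 < ℓ n) (hℓ1 : ∀ n, ℓ n ≤ 1) :
    ∃ x R : ℕ → ℝ, (∀ k, 1 ≤ R k) ∧
      (∀ n, ∀ θ ∈ Icc (q n) (q n + ℓ n), ∃ k ≥ n, R k * |Real.sin (θ - x k)| ≤ 1 / (n + 1)) ∧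
      ∀ θ, (∀ n, 3 * ℓ n ≤ |Real.sin (θ - q n)|) → Real.sin (θ - x 0) ≠ 0 ∧
        ∀ k, R k * |Real.sin (θ - x k)| ≤ R (k + 1) * |Real.sin (θ - x (k + 1))| := by
  have hlip : ∀ a b : ℝ, |Real.sin a| ≤ |Real.sin b| + |a - b| := fun a b => by
    have h1 := abs_sub_abs_le_abs_sub (Real.sin a) (Real.sin b)
    have h2 := Real.abs_sin_sub_sin_le a b
    linarith
  obtain ⟨B, hB0, hBs⟩ : ∃ B : ℕ → ℝ, B 0 = 1 ∧ ∀ n, B (n + 1) = 2 * B n / ℓ (n + 1) :=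
    ⟨fun n => Nat.rec 1 (fun n b => 2 * b / ℓ (n + 1)) n, rfl, fun n => rfl⟩
  have hB : ∀ n, 1 ≤ B n := fun n => by
    induction n with
    | zero => exact hB0.ge
    | succ n ih =>
      rw [hBs, le_div_iff₀ (hℓ0 _)]
      linarith [hℓ1 (n + 1)]
  obtain ⟨m, hm⟩ : ∃ m : ℕ → ℕ, ∀ n, 2 * (n + 1) * B n ≤ m n :=
    ⟨fun n => ⌈2 * (n + 1) * B n⌉₊, fun n => Nat.le_ceil _⟩
  have hm0 : ∀ n, (0 : ℝ) < m n := fun n =>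
    lt_of_lt_of_le (mul_pos (by positivity) (zero_lt_one.trans_le (hB n))) (hm n)
  obtain ⟨st, hst0, hsts⟩ : ∃ st : ℕ → ℕ × ℕ, st 0 = (0, 0) ∧ ∀ k, st (k + 1) =
      if (st k).2 < m (st k).1 then ((st k).1, (st k).2 + 1) else ((st k).1 + 1, 0) :=
    ⟨fun k => Nat.rec (0, 0) (fun _ s => if s.2 < m s.1 then (s.1, s.2 + 1) else (s.1 + 1, 0)) k,
      rfl, fun k => rfl⟩
  have hstm : ∀ k, (st k).2 ≤ m (st k).1 := fun k => by
    induction k with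
    | zero => simp [hst0]
    | succ k ih =>
      rw [hsts]
      split_ifs with h
      · exact h
      · exact Nat.zero_le _
  have hstk : ∀ k, (st k).1 ≤ k := fun k => by
    induction k with
    | zero => simp [hst0]
    | succ k ih =>
      rw [hsts]
      split_ifs with h
      · exact ih.trans k.le_succ
      · exact Nat.succ_le_succ ih
  have hstage : ∀ n, (∃ k, st k = (n, 0)) → ∀ i, i ≤ m n → ∃ k, st k = (n, i) := by
    intro n h0 i
    induction i with
    | zero => exact fun _ => h0
    | succ i ih =>
      intro hi
      obtain ⟨k, hk⟩ := ih (by omega)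
      exact ⟨k + 1, by rw [hsts, hk, if_pos (show i < m n by omega)]⟩
  have hstart : ∀ n, ∃ k, st k = (n, 0) := by
    intro n
    induction n with
    | zero => exact ⟨0, hst0⟩
    | succ n ih =>
      obtain ⟨k, hk⟩ := hstage n ih (m n) le_rfl
      exact ⟨k + 1, by rw [hsts, hk, if_neg (lt_irrefl _)]⟩
  have hreach : ∀ n i, i ≤ m n → ∃ k, st k = (n, i) := fun n => hstage n (hstart n)
  set X : ℕ × ℕ → ℝ := fun s => q s.1 + ℓ s.1 * (s.2 / m s.1) with hX
  set S : ℕ × ℕ → ℝ := fun s => B s.1 * (1 + s.2 / m s.1) with hS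
  refine ⟨fun k => X (st k), fun k => S (st k), fun k => ?_, fun n θ hθ => ?_, fun θ hθ => ?_⟩
  · have h1 := hB (st k).1
    have h2 : (0 : ℝ) ≤ (st k).2 / m (st k).1 := by positivity
    simp only [hS]
    nlinarith
  · have hℓ := hℓ0 n
    have hmn := hm0 n
    set y := (θ - q n) / ℓ n * m n with hy
    have hy0 : 0 ≤ y := by
      have : 0 ≤ θ - q n := by linarith [hθ.1]
      positivity
    have hym : y ≤ m n := by
      refine mul_le_of_le_one_left hmn.le ?_
      rw [div_le_one hℓ]
      linarith [hθ.2]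
    obtain ⟨k, hk⟩ := hreach n ⌊y⌋₊ (Nat.floor_le_of_le hym)
    refine ⟨k, by simpa [hk] using hstk k, ?_⟩
    have hfl : (⌊y⌋₊ : ℝ) ≤ y := Nat.floor_le hy0
    have hfl' : y < ⌊y⌋₊ + 1 := Nat.lt_floor_add_one y
    have hdiff : θ - (q n + ℓ n * (⌊y⌋₊ / m n)) = ℓ n / m n * (y - ⌊y⌋₊) := by
      rw [hy]
      field_simp
      ring
    have hsin : |Real.sin (θ - (q n + ℓ n * (⌊y⌋₊ / m n)))| ≤ 1 / m n := by
      refine Real.abs_sin_le_abs.trans ?_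
      rw [hdiff, abs_of_nonneg (mul_nonneg (by positivity) (by linarith))]
      calc ℓ n / m n * (y - ⌊y⌋₊) ≤ ℓ n / m n * 1 := by gcongr; linarith
        _ ≤ 1 / m n := by
          rw [mul_one]
          gcongr
          exact hℓ1 n
    have hS2 : B n * (1 + ⌊y⌋₊ / m n) ≤ B n * 2 := by
      have := hB n
      gcongr
      have : (⌊y⌋₊ : ℝ) / m n ≤ 1 := (div_le_one hmn).2 (hfl.trans hym)
      linarith
    simp only [hX, hS, hk]
    have hBn := hB n
    calc B n * (1 + ⌊y⌋₊ / m n) * |Real.sin (θ - (q n + ℓ n * (⌊y⌋₊ / m n)))|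
        ≤ B n * 2 * (1 / m n) := by gcongr
      _ ≤ 1 / (n + 1) := by
        rw [mul_one_div, div_le_div_iff₀ hmn (by positivity)]
        linarith [hm n]
  · have hfar : ∀ s : ℕ × ℕ, s.2 ≤ m s.1 → 2 * ℓ s.1 ≤ |Real.sin (θ - X s)| := by
      intro s hs
      have h1 := hlip (θ - q s.1) (θ - X s)
      have h2 : (s.2 : ℝ) / m s.1 ≤ 1 := (div_le_one (hm0 _)).2 (by exact_mod_cast hs)
      have h3 : (θ - q s.1) - (θ - X s) = ℓ s.1 * (s.2 / m s.1) := by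
        simp only [hX]
        ring
      have h4 := hℓ0 s.1
      rw [h3, abs_of_nonneg (show 0 ≤ ℓ s.1 * (s.2 / m s.1) by positivity)] at h1
      nlinarith [hθ s.1]
    refine ⟨fun h0 => ?_, fun k => ?_⟩
    · have := hfar _ (hstm 0)
      rw [h0, abs_zero] at this
      linarith [hℓ0 (st 0).1]
    · have hk1 := hfar _ (hstm (k + 1))
      have hkm := hstm k
      beta_reduce
      rw [hsts] at hk1 ⊢
      generalize st k = s at hk1 hkm ⊢
      obtain ⟨n, i⟩ := s
      have hBn := hB n
      have hmn := hm0 n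
      have hi : (i : ℝ) / m n ≤ 1 := (div_le_one hmn).2 (by exact_mod_cast hkm)
      have hi0 : (0 : ℝ) ≤ i / m n := by positivity
      split_ifs at hk1 ⊢ with h
      · have h1 := hlip (θ - X (n, i)) (θ - X (n, i + 1))
        have h3 : (θ - X (n, i)) - (θ - X (n, i + 1)) = ℓ n * (1 / m n) := by
          simp only [hX]
          push_cast
          ring
        have h4 := hℓ0 n
        rw [h3, abs_of_nonneg (show 0 ≤ ℓ n * (1 / m n) by positivity)] at h1
        generalize |Real.sin (θ - X (n, i))| = c at *
        generalize |Real.sin (θ - X (n, i + 1))| = c' at *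
        simp only [hS] at hk1 ⊢
        push_cast
        rw [add_div, mul_assoc, mul_assoc]
        refine mul_le_mul_of_nonneg_left ?_ (by linarith)
        have hr : (0 : ℝ) ≤ 1 / m n := by positivity
        calc (1 + (i : ℝ) / m n) * c
            ≤ (1 + (i : ℝ) / m n) * c' + 1 / m n * ((1 + (i : ℝ) / m n) * ℓ n) := by nlinarith
          _ ≤ (1 + (i : ℝ) / m n) * c' + 1 / m n * c' := by
            gcongr
            nlinarith
          _ = _ := by ring
      · have h1 := Real.abs_sin_le_one (θ - X (n, i))
        have h4 := hℓ0 (n + 1)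
        calc S (n, i) * |Real.sin (θ - X (n, i))| ≤ B n * 2 * 1 := by
              simp only [hS]
              gcongr
              linarith
          _ ≤ 2 * B n / ℓ (n + 1) * (2 * ℓ (n + 1)) := by
            field_simp
            linarith
          _ ≤ S (n + 1, 0) * |Real.sin (θ - X (n + 1, 0))| := by
            simp only [hS, hBs]
            simp only [Nat.cast_zero, zero_div, add_zero, mul_one]
            gcongr

lemma exists_set_null_on_intervals (q ℓ : ℕ → ℝ) (hℓ0 : ∀ n, 0 < ℓ n) (hℓ1 : ∀ n, ℓ n ≤ 1) :
    ∃ E : Set ℂ, MeasurableSet E ∧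
      (∀ n, ∀ θ ∈ Icc (q n) (q n + ℓ n), volume (projCoord θ '' E) = 0) ∧
      ∀ θ, (∀ n, 3 * ℓ n ≤ |Real.sin (θ - q n)|) → volume (projCoord θ '' E) ≠ 0 := by
  obtain ⟨x, R, hR, hnull, hpos⟩ := exists_sweep (fun n => q n.unpair.1) (fun n => ℓ n.unpair.1)
    (fun n => hℓ0 _) (fun n => hℓ1 _)
  obtain ⟨E, hE, hEnull, hEpos⟩ := exists_set_of_directions x R hR
  refine ⟨E, hE, fun n θ hθ => hEnull θ fun ε hε => frequently_atTop.2 fun K => ?_,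
    fun θ hθ => ?_⟩
  · obtain ⟨j, hj⟩ := exists_nat_one_div_lt hε
    have hle : max K j ≤ Nat.pair n (max K j) := Nat.right_le_pair _ _
    obtain ⟨k, hk, hk'⟩ := hnull (Nat.pair n (max K j)) θ (by simpa using hθ)
    refine ⟨k, (le_max_left K j).trans (hle.trans hk), hk'.trans (le_trans ?_ hj.le)⟩
    have : (j : ℝ) ≤ Nat.pair n (max K j) := by exact_mod_cast (le_max_right K j).trans hle
    gcongr
  · obtain ⟨h0, h⟩ := hpos θ fun n => hθ _
    exact hEpos θ h0 h

lemma exists_volume_abs_sin_lt_le (q : ℝ) {ε : ℝ≥0∞} (hε : 0 < ε) :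
    ∃ ℓ : ℝ, 0 < ℓ ∧ ℓ ≤ 1 ∧
      volume.restrict (Ico 0 π) {θ | |Real.sin (θ - q)| < 3 * ℓ} ≤ ε := by
  set s : ℕ → Set ℝ := fun n => {θ | |Real.sin (θ - q)| < 3 * (1 / (n + 1))} with hs
  have hmeas : ∀ n, MeasurableSet (s n) := fun n =>
    (isOpen_lt (by fun_prop) continuous_const).measurableSet
  have hanti : Antitone s := fun i j hij θ hθ => by
    simp only [hs, mem_ofPred_eq] at hθ ⊢
    refine hθ.trans_le ?_
    gcongr
  have hinter : ⋂ n, s n ⊆ range fun n : ℤ => n * π + q := by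
    intro θ hθ
    have h0 : Real.sin (θ - q) = 0 := by
      by_contra h
      obtain ⟨n, hn⟩ := exists_nat_one_div_lt (div_pos (abs_pos.2 h) (zero_lt_three' ℝ))
      have := mem_iInter.1 hθ n
      simp only [hs, mem_ofPred_eq] at this
      linarith
    obtain ⟨n, hn⟩ := Real.sin_eq_zero_iff.1 h0
    exact ⟨n, by simp only [hn]; ring⟩
  have hlim := tendsto_measure_iInter_atTop (μ := volume.restrict (Ico 0 π))
    (fun n => (hmeas n).nullMeasurableSet) hanti ⟨0, measure_ne_top _ _⟩
  rw [measure_mono_null hinter ((countable_range _).measure_zero _)] at hlim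
  obtain ⟨n, hn⟩ := (hlim.eventually_le_const hε).exists
  refine ⟨1 / (n + 1), by positivity, ?_, hn⟩
  rw [div_le_one (by positivity)]
  linarith [n.cast_nonneg (α := ℝ)]

lemma exists_set_null_dense_pos_off_small {ε : ℝ≥0∞} (hε : ε ≠ 0) :
    ∃ E : Set ℂ, MeasurableSet E ∧
      (∀ a b : ℝ, a < b → ∃ c d, c < d ∧ Icc c d ⊆ Ioo a b ∧
        ∀ θ ∈ Icc c d, volume (projCoord θ '' E) = 0) ∧
      volume.restrict (Ico 0 π) {θ | volume (projCoord θ '' E) = 0} ≤ ε := by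
  obtain ⟨δ, hδ, hδε⟩ := ENNReal.exists_pos_sum_of_countable' hε ℕ
  set q := TopologicalSpace.denseSeq ℝ
  choose ℓ hℓ0 hℓ1 hℓ using fun n => exists_volume_abs_sin_lt_le (q n) (hδ n)
  obtain ⟨E, hE, hnull, hpos⟩ := exists_set_null_on_intervals q ℓ hℓ0 hℓ1
  refine ⟨E, hE, fun a b hab => ?_, ?_⟩
  · obtain ⟨_, ⟨n, rfl⟩, hn⟩ :=
      (TopologicalSpace.denseRange_denseSeq ℝ).exists_between hab
    have hlt : q n < min (q n + ℓ n) ((q n + b) / 2) :=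
      lt_min (by linarith [hℓ0 n]) (by linarith [hn.2])
    refine ⟨q n, _, hlt, fun θ hθ => ⟨hn.1.trans_le hθ.1, ?_⟩, fun θ hθ =>
      hnull n θ ⟨hθ.1, hθ.2.trans (min_le_left _ _)⟩⟩
    exact (hθ.2.trans (min_le_right _ _)).trans_lt (by linarith [hn.2])
  · have hsub : {θ | volume (projCoord θ '' E) = 0} ⊆
        ⋃ n, {θ | |Real.sin (θ - q n)| < 3 * ℓ n} := by
      intro θ hθ
      by_contra h
      simp only [mem_iUnion, mem_ofPred_eq, not_exists, not_lt] at h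
      exact hpos θ h hθ
    calc _ ≤ _ := measure_mono hsub
      _ ≤ _ := measure_iUnion_le _
      _ ≤ ∑' n, δ n := ENNReal.tsum_le_tsum hℓ
      _ ≤ ε := hδε.le

/-- There exists a Borel set `E ⊆ ℝ² ≅ ℂ` such that (1) `ℋ¹(P_θ(E)) > 0`
for a.e. `θ ∈ [0,π)`, and (2) for every Borel measure `μ` with `μ(E) > 0` and every
nondegenerate interval `I ⊆ [0,π)`, the set of `θ ∈ I` for which `P_θ μ` fails to be
absolutely continuous with square-integrable density has positive Lebesgue measure. -/
theorem statement4 :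
    ∃ E : Set ℂ, MeasurableSet E ∧
      (∀ᵐ θ ∂(volume.restrict (Set.Ico 0 π)), 0 < (μH[1] : Measure ℂ) (projPt θ '' E)) ∧
      ∀ μ : Measure ℂ, 0 < μ E →
        ∀ I : Set ℝ, I.OrdConnected → I ⊆ Set.Ico 0 π → I.Nontrivial →
          0 < volume {θ ∈ I | projL2sq θ μ = ⊤} := by
  choose E hE hnull hpos using fun p : ℕ =>
    exists_set_null_dense_pos_off_small (ε := (p + 1 : ℝ≥0∞)⁻¹) (by simp)
  refine ⟨⋃ p, E p, MeasurableSet.iUnion hE, ?_, fun μ hμ I hI hIsub hIn => ?_⟩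
  · rw [ae_iff]
    refine le_antisymm (ENNReal.le_of_forall_pos_le_add fun ε hε _ => ?_) zero_le
    obtain ⟨p, hp⟩ := ENNReal.exists_inv_nat_lt (ENNReal.coe_pos.2 hε).ne'
    rw [zero_add]
    refine (measure_mono fun θ hθ => ?_).trans ((hpos p).trans (le_trans ?_ hp.le))
    · simp only [mem_ofPred_eq, not_lt, nonpos_iff_eq_zero, hausdorffMeasure_image_projPt] at hθ ⊢
      exact measure_mono_null (image_mono (subset_iUnion E p)) hθ
    · rw [ENNReal.inv_le_inv]
      exact le_self_add
  · obtain ⟨p, hp⟩ : ∃ p, μ (E p) ≠ 0 := by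
      by_contra! h
      exact hμ.ne' (measure_iUnion_null h)
    obtain ⟨a, ha, b, hb, hab⟩ := hIn.exists_lt
    obtain ⟨c, d, hcd, hsub, hcdnull⟩ := hnull p a b hab
    have hle : Icc c d ⊆ {θ ∈ I | projL2sq θ μ = ⊤} := fun θ hθ =>
      ⟨hI.out ha hb (Ioo_subset_Icc_self (hsub hθ)), projL2sq_eq_top hp (hcdnull θ hθ)⟩
    refine lt_of_lt_of_le ?_ (measure_mono hle)
    rw [Real.volume_Icc, ENNReal.ofReal_pos]
    linarith
end
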